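/- arXiv:1511.02387 — 4 statements merged into one kernel-verified Lean document; each statement's English description precedes it below -/
import Mathlib

section
/- Fix a real number β > 0. For each n, let P(n, β) be the probability, under the Plancherel measure on partitions of n, that a random partition λ is β-sum-flexible. Then P(n, β) → 1 as n → ∞. -/
/-- A partition, encoded by its weakly decreasing (0-indexed) sequence of parts,
eventually zero. -/
def IsPtnFun (f : ℕ → ℕ) : Prop :=
  Antitone f ∧ ∃ N, ∀ i, N ≤ i → f i = 0

/-- The size (number of boxes) of a partition: the sum of its parts. -/
noncomputable def psize (f : ℕ → ℕ) : ℕ := ∑' i, f i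

/-- The conjugate partition: `(conjFun f) j = #{i : f i ≥ j + 1}` is the length of
the `(j+1)`-st column of the Young diagram of `f`.  There are `f 0` columns, of
lengths `conjFun f 0 ≥ conjFun f 1 ≥ ⋯ ≥ conjFun f (f 0 - 1)`; hence the column
lengths sorted in *increasing* order are `a_k = conjFun f (f 0 - k)` for
`k = 1, …, f 0`. -/
noncomputable def conjFun (f : ℕ → ℕ) : ℕ → ℕ := fun j => {i | j + 1 ≤ f i}.ncard

/-- `λ` is `β`-sum-flexible: with its column lengths sorted increasingly as
`a_1 ≤ a_2 ≤ … ≤ a_m` (`m = f 0`), one has `a_1 = 1` and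
`a_k ≤ ⌈β (a_1 + ⋯ + a_k)⌉` for every `1 ≤ k ≤ m`. -/
noncomputable def SumFlexible (β : ℝ) (f : ℕ → ℕ) : Prop :=
  0 < f 0 ∧ conjFun f (f 0 - 1) = 1 ∧
    ∀ k, 1 ≤ k → k ≤ f 0 →
      (conjFun f (f 0 - k) : ℤ) ≤
        ⌈β * ∑ j ∈ Finset.Icc 1 k, (conjFun f (f 0 - j) : ℝ)⌉

/-- `T` is a standard Young tableau of shape `f`. -/
def IsSYT (f : ℕ → ℕ) (T : ℕ × ℕ → ℕ) : Prop :=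
  (∀ p : ℕ × ℕ, ¬ p.2 < f p.1 → T p = 0) ∧
  (∀ i j, j + 1 < f i → T (i, j) < T (i, j + 1)) ∧
  (∀ i j, j < f (i + 1) → T (i, j) < T (i + 1, j)) ∧
  Set.BijOn T {p : ℕ × ℕ | p.2 < f p.1} (Set.Icc 1 (psize f))

/-- `f^λ`, the number of standard Young tableaux of shape `λ`. -/
noncomputable def sytCount (f : ℕ → ℕ) : ℕ := Nat.card {T : ℕ × ℕ → ℕ // IsSYT f T}

/-- Add a box at the end of row `k`. -/
def addBox (k : ℕ) (f : ℕ → ℕ) : ℕ → ℕ := Function.update f k (f k + 1)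

/-- Remove the last box of row `k`. -/
def removeBox (k : ℕ) (f : ℕ → ℕ) : ℕ → ℕ := Function.update f k (f k - 1)

lemma addBox_apply (k : ℕ) (f : ℕ → ℕ) (i : ℕ) :
    addBox k f i = if i = k then f i + 1 else f i := by
  by_cases h : i = k
  · subst h; simp [addBox]
  · simp [addBox, h]

lemma removeBox_apply (k : ℕ) (f : ℕ → ℕ) (i : ℕ) :
    removeBox k f i = if i = k then f i - 1 else f i := by
  by_cases h : i = k
  · subst h; simp [removeBox]
  · simp [removeBox, h]

lemma removeBox_addBox (k : ℕ) (f : ℕ → ℕ) : removeBox k (addBox k f) = f := by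
  ext i; simp only [removeBox_apply, addBox_apply]; split_ifs <;> omega

lemma addBox_removeBox {k : ℕ} {f : ℕ → ℕ} (h : 0 < f k) : addBox k (removeBox k f) = f := by
  ext i; simp only [removeBox_apply, addBox_apply]; split_ifs with hi
  · subst hi; omega
  · rfl

lemma removeBox_addBox_comm {j k : ℕ} (hjk : j ≠ k) (f : ℕ → ℕ) :
    removeBox j (addBox k f) = addBox k (removeBox j f) := by
  ext i; simp only [removeBox_apply, addBox_apply]; split_ifs <;> omega

lemma addBox_comm (j k : ℕ) (f : ℕ → ℕ) :
    addBox j (addBox k f) = addBox k (addBox j f) := by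
  ext i; simp only [addBox_apply]; split_ifs <;> omega

lemma addBox_injective (k : ℕ) : Function.Injective (addBox k) := fun f g h => by
  rw [← removeBox_addBox k f, h, removeBox_addBox]

namespace IsPtnFun

variable {f : ℕ → ℕ}

lemma succ_le (hf : IsPtnFun f) (i : ℕ) : f (i + 1) ≤ f i := hf.1 (Nat.le_succ i)

lemma addBox_iff (hf : IsPtnFun f) (k : ℕ) :
    IsPtnFun (addBox k f) ↔ ∀ i, i + 1 = k → f k < f i := by
  constructor
  · rintro h i rfl
    have := h.succ_le i
    simp only [addBox_apply, if_true] at this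
    rw [if_neg (by omega)] at this
    omega
  · intro h
    refine ⟨antitone_nat_of_succ_le fun i => ?_, ?_⟩
    · have h1 := hf.succ_le i
      simp only [addBox_apply]
      split_ifs with h2 h3 h3
      · omega
      · have := h i h2
        subst h2
        omega
      · omega
      · omega
    · obtain ⟨N, hN⟩ := hf.2
      refine ⟨max N (k + 1), fun i hi => ?_⟩
      rw [addBox_apply, if_neg (by omega)]
      exact hN i (by omega)

lemma addBox_zero (hf : IsPtnFun f) : IsPtnFun (addBox 0 f) :=
  (hf.addBox_iff 0).2 fun i hi => by omega

lemma removeBox (hf : IsPtnFun f) {k : ℕ} (h : f (k + 1) < f k) :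
    IsPtnFun (removeBox k f) := by
  refine ⟨antitone_nat_of_succ_le fun i => ?_, ?_⟩
  · have h1 := hf.succ_le i
    simp only [removeBox_apply]
    split_ifs with h2 h3 h3
    · omega
    · omega
    · subst h3; omega
    · omega
  · obtain ⟨N, hN⟩ := hf.2
    refine ⟨N, fun i hi => ?_⟩
    rw [removeBox_apply, hN i hi]
    split_ifs <;> rfl

lemma psize_eq_sum {N : ℕ} (hN : ∀ i, N ≤ i → f i = 0) :
    psize f = ∑ i ∈ Finset.range N, f i :=
  tsum_eq_sum fun i hi => hN i (by simpa using hi)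

lemma psize_addBox (hf : IsPtnFun f) (k : ℕ) : psize (addBox k f) = psize f + 1 := by
  obtain ⟨N, hN⟩ := hf.2
  have h1 : ∀ i, N + (k + 1) ≤ i → f i = 0 := fun i hi => hN i (by omega)
  have h2 : ∀ i, N + (k + 1) ≤ i → addBox k f i = 0 := fun i hi => by
    rw [addBox_apply, if_neg (by omega), h1 i hi]
  rw [psize_eq_sum h1, psize_eq_sum h2]
  have : ∀ i, addBox k f i = f i + if i = k then 1 else 0 := fun i => by
    rw [addBox_apply]; split_ifs <;> omega
  simp only [this, Finset.sum_add_distrib, Finset.sum_ite_eq', Finset.mem_range]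
  rw [if_pos (by omega)]

lemma psize_removeBox (hf : IsPtnFun f) {k : ℕ} (h : f (k + 1) < f k) :
    psize (_root_.removeBox k f) + 1 = psize f := by
  rw [← (hf.removeBox h).psize_addBox k, addBox_removeBox (by omega)]

lemma sum_range_le_psize (hf : IsPtnFun f) (m : ℕ) :
    ∑ i ∈ Finset.range m, f i ≤ psize f := by
  obtain ⟨N, hN⟩ := hf.2
  rw [psize_eq_sum (N := N + m) fun i hi => hN i (by omega)]
  exact Finset.sum_le_sum_of_subset (Finset.range_mono (by omega))

lemma apply_le_psize (hf : IsPtnFun f) (i : ℕ) : f i ≤ psize f :=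
  (Finset.single_le_sum (f := f) (fun _ _ => Nat.zero_le _)
    (Finset.self_mem_range_succ i)).trans (hf.sum_range_le_psize (i + 1))

lemma apply_eq_zero (hf : IsPtnFun f) {i : ℕ} (hi : psize f ≤ i) : f i = 0 := by
  by_contra h
  have h1 : ∑ j ∈ Finset.range (i + 1), 1 ≤ ∑ j ∈ Finset.range (i + 1), f j :=
    Finset.sum_le_sum fun j hj => by
      have := hf.1 (Nat.lt_succ_iff.1 (Finset.mem_range.1 hj))
      omega
  have h2 := hf.sum_range_le_psize (i + 1)
  simp at h1
  omega

lemma eq_zero_of_psize (hf : IsPtnFun f) (h : psize f = 0) : f = 0 :=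
  funext fun i => hf.apply_eq_zero (by omega)

end IsPtnFun

lemma isPtnFun_zero : IsPtnFun 0 := ⟨fun _ _ _ => le_rfl, 0, fun _ _ => rfl⟩

lemma psize_zero : psize 0 = 0 := by simp [psize]

lemma finite_setOf_psize_eq (n : ℕ) : {f : ℕ → ℕ | IsPtnFun f ∧ psize f = n}.Finite := by
  refine Set.Finite.of_injOn (f := fun f (i : Fin n) => f i)
    (t := {g : Fin n → ℕ | ∀ i, g i ∈ Set.Iic n}) ?_ ?_ (Set.Finite.pi' fun _ => Set.finite_Iic n)
  · rintro f ⟨hf, rfl⟩ i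
    exact hf.apply_le_psize i
  · rintro f ⟨hf, hfn⟩ g ⟨hg, hgn⟩ h
    ext i
    by_cases hi : i < n
    · exact congrFun h ⟨i, hi⟩
    · rw [hf.apply_eq_zero (by omega), hg.apply_eq_zero (by omega)]

/-- The finite set of partitions of `n`. -/
noncomputable def ptns (n : ℕ) : Finset (ℕ → ℕ) := (finite_setOf_psize_eq n).toFinset

lemma mem_ptns {n : ℕ} {f : ℕ → ℕ} : f ∈ ptns n ↔ IsPtnFun f ∧ psize f = n := by
  simp [ptns]

lemma ptns_zero : ptns 0 = {0} := by
  ext f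
  rw [mem_ptns, Finset.mem_singleton]
  exact ⟨fun h => h.1.eq_zero_of_psize h.2, by rintro rfl; exact ⟨isPtnFun_zero, psize_zero⟩⟩

lemma addBox_mem_ptns {n k : ℕ} {f : ℕ → ℕ} (hf : f ∈ ptns n) (h : IsPtnFun (addBox k f)) :
    addBox k f ∈ ptns (n + 1) := by
  rw [mem_ptns] at hf ⊢
  exact ⟨h, by rw [hf.1.psize_addBox, hf.2]⟩

lemma removeBox_mem_ptns {n k : ℕ} {f : ℕ → ℕ} (hf : f ∈ ptns (n + 1)) (h : f (k + 1) < f k) :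
    removeBox k f ∈ ptns n := by
  rw [mem_ptns] at hf ⊢
  exact ⟨hf.1.removeBox h, by have := hf.1.psize_removeBox h; omega⟩

lemma lt_removeBox_iff {f : ℕ → ℕ} {k : ℕ} (h : f (k + 1) < f k) (i j : ℕ) :
    j < removeBox k f i ↔ j < f i ∧ (i, j) ≠ (k, f k - 1) := by
  rw [removeBox_apply, Ne, Prod.mk.injEq]
  split_ifs with hi
  · subst hi; omega
  · simp [hi]

lemma IsSYT.le_psize {f : ℕ → ℕ} {T : ℕ × ℕ → ℕ} (hT : IsSYT f T) (p : ℕ × ℕ) :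
    T p ≤ psize f := by
  by_cases hp : p.2 < f p.1
  · exact (hT.2.2.2.mapsTo hp).2
  · rw [hT.1 p hp]; exact Nat.zero_le _

lemma IsSYT.exists_corner {f : ℕ → ℕ} {T : ℕ × ℕ → ℕ} (hT : IsSYT f T) (h : 0 < psize f) :
    ∃ k, f (k + 1) < f k ∧ T (k, f k - 1) = psize f := by
  obtain ⟨⟨i, j⟩, hij, hv⟩ := hT.2.2.2.surjOn (Set.right_mem_Icc.2 h)
  simp only [Set.mem_ofPred_eq] at hij
  have h1 : ¬ j + 1 < f i := fun hj => by
    have := hT.2.1 i j hj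
    have := hT.le_psize (i, j + 1)
    omega
  have h2 : ¬ j < f (i + 1) := fun hj => by
    have := hT.2.2.1 i j hj
    have := hT.le_psize (i + 1, j)
    omega
  refine ⟨i, by omega, ?_⟩
  rw [show f i - 1 = j by omega, hv]

lemma IsSYT.update_zero {f : ℕ → ℕ} {T : ℕ × ℕ → ℕ} (hf : IsPtnFun f) (hT : IsSYT f T) {k : ℕ}
    (hk : f (k + 1) < f k) (hv : T (k, f k - 1) = psize f) :
    IsSYT (removeBox k f) (Function.update T (k, f k - 1) 0) := by
  have hs := hf.psize_removeBox hk
  have hp : (k, f k - 1) ∈ {p : ℕ × ℕ | p.2 < f p.1} := by simp; omega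
  refine ⟨fun p hp => ?_, fun i j hj => ?_, fun i j hj => ?_, ?_⟩
  · rw [lt_removeBox_iff hk] at hp
    by_cases h : p = (k, f k - 1)
    · rw [h, Function.update_self]
    · rw [Function.update_of_ne h]
      exact hT.1 p fun h' => hp ⟨h', h⟩
  · have h1 : j < removeBox k f i := by omega
    rw [lt_removeBox_iff hk] at hj h1
    rw [Function.update_of_ne hj.2, Function.update_of_ne h1.2]
    exact hT.2.1 i j hj.1
  · have h1 : j < removeBox k f i := lt_of_lt_of_le hj ((hf.removeBox hk).succ_le i)
    rw [lt_removeBox_iff hk] at hj h1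
    rw [Function.update_of_ne hj.2, Function.update_of_ne h1.2]
    exact hT.2.2.1 i j hj.1
  · have h1 : {p : ℕ × ℕ | p.2 < removeBox k f p.1} =
        {p : ℕ × ℕ | p.2 < f p.1} \ {(k, f k - 1)} := by
      ext p
      simp [lt_removeBox_iff hk]
    have h2 : Set.Icc 1 (psize (removeBox k f)) = Set.Icc 1 (psize f) \ {psize f} := by
      ext x
      simp
      omega
    have h3 := hT.2.2.2.sdiff_singleton hp
    rw [hv] at h3
    rw [h1, h2]
    refine h3.congr fun p hp => ?_
    rw [Function.update_of_ne hp.2]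

lemma IsSYT.update_psize {f : ℕ → ℕ} {T : ℕ × ℕ → ℕ} (hf : IsPtnFun f) {k : ℕ}
    (hk : f (k + 1) < f k) (hT : IsSYT (removeBox k f) T) :
    IsSYT f (Function.update T (k, f k - 1) (psize f)) := by
  have hs := hf.psize_removeBox hk
  refine ⟨fun p hp => ?_, fun i j hj => ?_, fun i j hj => ?_, ?_⟩
  · rw [Function.update_of_ne]
    · exact hT.1 p fun h => hp ((lt_removeBox_iff hk _ _).1 h).1
    · rintro rfl
      exact hp (show f k - 1 < f k by omega)
  · have h1 : (i, j) ≠ (k, f k - 1) := by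
      rintro h; cases h; omega
    rw [Function.update_of_ne h1]
    by_cases h2 : (i, j + 1) = (k, f k - 1)
    · rw [h2, Function.update_self]
      have := hT.le_psize (i, j)
      omega
    · rw [Function.update_of_ne h2]
      exact hT.2.1 i j ((lt_removeBox_iff hk _ _).2 ⟨hj, h2⟩)
  · have h1 : (i, j) ≠ (k, f k - 1) := by
      rintro h; cases h; omega
    rw [Function.update_of_ne h1]
    by_cases h2 : (i + 1, j) = (k, f k - 1)
    · rw [h2, Function.update_self]
      have := hT.le_psize (i, j)
      omega
    · rw [Function.update_of_ne h2]
      exact hT.2.2.1 i j ((lt_removeBox_iff hk _ _).2 ⟨hj, h2⟩)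
  · have h1 : {p : ℕ × ℕ | p.2 < f p.1} =
        insert (k, f k - 1) {p : ℕ × ℕ | p.2 < removeBox k f p.1} := by
      ext ⟨i, j⟩
      simp only [Set.mem_ofPred_eq, Set.mem_insert_iff, lt_removeBox_iff hk]
      by_cases h : (i, j) = (k, f k - 1)
      · cases h; simp; omega
      · simp [h]
    have h2 : Set.Icc 1 (psize f) = insert (psize f) (Set.Icc 1 (psize (removeBox k f))) := by
      ext x
      simp
      omega
    have h3 : Set.BijOn (Function.update T (k, f k - 1) (psize f))
        {p : ℕ × ℕ | p.2 < removeBox k f p.1} (Set.Icc 1 (psize (removeBox k f))) := by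
      refine hT.2.2.2.congr fun p hp => ?_
      rw [Function.update_of_ne ((lt_removeBox_iff hk _ _).1 hp).2]
    rw [h1, h2]
    have h4 := h3.insert (a := (k, f k - 1)) (by
      rw [Function.update_self]
      simp
      omega)
    rwa [Function.update_self] at h4

lemma finite_isSYT {f : ℕ → ℕ} (hf : IsPtnFun f) : Finite {T : ℕ × ℕ → ℕ // IsSYT f T} := by
  refine Set.Finite.to_subtype (s := {T | IsSYT f T}) <| Set.Finite.of_injOn
    (f := fun T (p : Fin (psize f) × Fin (psize f)) => T (p.1, p.2))
    (t := {g | ∀ i, g i ∈ Set.Iic (psize f)}) ?_ ?_ (Set.Finite.pi' fun _ => Set.finite_Iic _)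
  · exact fun T hT p => hT.le_psize _
  · intro T hT T' hT' h
    ext ⟨i, j⟩
    by_cases hij : j < f i
    · have h1 : j < psize f := hij.trans_le (hf.apply_le_psize i)
      have h2 : i < psize f := by
        by_contra h2
        rw [hf.apply_eq_zero (by omega)] at hij
        omega
      exact congrFun h (⟨i, h2⟩, ⟨j, h1⟩)
    · rw [hT.1 _ hij, hT'.1 _ hij]

lemma sytCount_eq_sum {n N : ℕ} {f : ℕ → ℕ} (hf : f ∈ ptns (n + 1)) (hN : n < N) :
    sytCount f = ∑ k ∈ Finset.range N with f (k + 1) < f k, sytCount (removeBox k f) := by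
  obtain ⟨hf, hs⟩ := mem_ptns.1 hf
  set s := (Finset.range N).filter fun k => f (k + 1) < f k with hsdef
  have hmem : ∀ k : s, f (k + 1) < f k := fun k => (Finset.mem_filter.1 k.2).2
  have hfin : ∀ k : s, Finite {T : ℕ × ℕ → ℕ // IsSYT (removeBox k f) T} := fun k =>
    finite_isSYT (hf.removeBox (hmem k))
  let e : (Σ k : s, {T : ℕ × ℕ → ℕ // IsSYT (removeBox k f) T}) →
      {T : ℕ × ℕ → ℕ // IsSYT f T} := fun x =>
    ⟨Function.update x.2.1 ((x.1 : ℕ), f x.1 - 1) (psize f), x.2.2.update_psize hf (hmem x.1)⟩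
  have he : Function.Bijective e := by
    constructor
    · rintro ⟨⟨k, hk⟩, T, hT⟩ ⟨⟨l, hl⟩, T', hT'⟩ h
      have h0 : Function.update T (k, f k - 1) (psize f) =
          Function.update T' (l, f l - 1) (psize f) := congrArg Subtype.val h
      have hkl : k = l := by
        by_contra hkl
        have h1 := congrFun h0 (k, f k - 1)
        rw [Function.update_self, Function.update_of_ne (by simp [hkl])] at h1
        have h2 := hT'.le_psize (k, f k - 1)
        have h3 := hf.psize_removeBox (hmem ⟨l, hl⟩)
        simp only at h2 h3
        omega
      subst hkl
      have hTT : T = T' := by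
        ext p
        by_cases hp : p = (k, f k - 1)
        · have h1 : ¬ p.2 < removeBox k f p.1 := by
            rw [lt_removeBox_iff (hmem ⟨k, hk⟩)]
            exact fun h => h.2 hp
          rw [hT.1 p h1, hT'.1 p h1]
        · have h1 := congrFun h0 p
          rwa [Function.update_of_ne hp, Function.update_of_ne hp] at h1
      subst hTT
      rfl
    · rintro ⟨T, hT⟩
      obtain ⟨k, hk, hv⟩ := hT.exists_corner (by omega)
      have hks : k ∈ s := by
        rw [hsdef, Finset.mem_filter, Finset.mem_range]
        refine ⟨?_, hk⟩
        by_contra h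
        have := hf.apply_eq_zero (i := k) (by omega)
        omega
      refine ⟨⟨⟨k, hks⟩, ⟨_, hT.update_zero hf hk hv⟩⟩, Subtype.ext ?_⟩
      simp [e, ← hv]
  rw [sytCount, ← Nat.card_congr (Equiv.ofBijective e he), Nat.card_sigma]
  exact Finset.sum_coe_sort s fun k => sytCount (removeBox k f)

lemma sytCount_zero : sytCount 0 = 1 := by
  rw [sytCount, Nat.card_eq_one_iff_unique]
  refine ⟨⟨fun T T' => Subtype.ext (funext fun p => ?_)⟩, ⟨⟨0, ?_⟩⟩⟩
  · rw [T.2.1 p (by simp), T'.2.1 p (by simp)]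
  · refine ⟨fun _ _ => rfl, fun i j h => ?_, fun i j h => ?_, ?_⟩
    · simp at h
    · simp at h
    · simp [psize_zero]

open Classical in
/-- The number of standard Young tableaux of shape `f`, extended by zero to functions which are
not partitions. -/
noncomputable def ptnDim (f : ℕ → ℕ) : ℝ := if IsPtnFun f then (sytCount f : ℝ) else 0

lemma ptnDim_of_isPtnFun {f : ℕ → ℕ} (hf : IsPtnFun f) : ptnDim f = sytCount f := if_pos hf

lemma ptnDim_of_not {f : ℕ → ℕ} (hf : ¬ IsPtnFun f) : ptnDim f = 0 := if_neg hf

lemma ptnDim_nonneg (f : ℕ → ℕ) : 0 ≤ ptnDim f := by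
  unfold ptnDim; split_ifs <;> positivity

lemma ptnDim_zero : ptnDim 0 = 1 := by
  rw [ptnDim_of_isPtnFun isPtnFun_zero, sytCount_zero, Nat.cast_one]

lemma ptnDim_eq_sum_removeBox {n N : ℕ} {f : ℕ → ℕ} (hf : f ∈ ptns (n + 1)) (hN : n < N) :
    ptnDim f = ∑ k ∈ Finset.range N with f (k + 1) < f k, ptnDim (removeBox k f) := by
  have hp := (mem_ptns.1 hf).1
  rw [ptnDim_of_isPtnFun hp, sytCount_eq_sum hf hN, Nat.cast_sum]
  refine Finset.sum_congr rfl fun k hk => ?_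
  rw [ptnDim_of_isPtnFun (hp.removeBox (Finset.mem_filter.1 hk).2)]

lemma corner_iff_of_isPtnFun_addBox_removeBox {f : ℕ → ℕ} (hf : IsPtnFun f) {j k : ℕ}
    (hjk : j ≠ k)
    (h : IsPtnFun (addBox k (removeBox j f))) :
    f (j + 1) < f j ↔ IsPtnFun (addBox k f) ∧ addBox k f (j + 1) < addBox k f j := by
  rw [hf.addBox_iff]
  constructor
  · intro hj
    constructor
    · rintro i rfl
      have := h.succ_le i
      simp only [addBox_apply, removeBox_apply] at this
      have := hf.succ_le i
      split_ifs at * <;> omega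
    · have := h.succ_le j
      simp only [addBox_apply, removeBox_apply] at *
      split_ifs at * <;> omega
  · rintro ⟨-, hj⟩
    simp only [addBox_apply] at hj
    split_ifs at * <;> omega

open Classical in
lemma card_addable {n N : ℕ} {f : ℕ → ℕ} (hf : f ∈ ptns n) (hN : n < N) :
    (((Finset.range N).filter fun k => IsPtnFun (addBox k f)).card : ℕ) =
      ((Finset.range N).filter fun k => f (k + 1) < f k).card + 1 := by
  obtain ⟨hp, hs⟩ := mem_ptns.1 hf
  obtain ⟨M, rfl⟩ : ∃ M, N = M + 1 := ⟨N - 1, by omega⟩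
  have h1 : ((Finset.range (M + 1)).filter fun k => IsPtnFun (addBox k f)) =
      insert 0 (((Finset.range (M + 1)).filter fun k => f (k + 1) < f k).map
        ⟨Nat.succ, Nat.succ_injective⟩) := by
    ext k
    rcases k with - | k
    · simp [hp.addBox_zero]
    · simp only [Finset.mem_filter, Finset.mem_range, Finset.mem_insert, Finset.mem_map,
        Function.Embedding.coeFn_mk, hp.addBox_iff]
      constructor
      · rintro ⟨h1, h2⟩
        exact Or.inr ⟨k, ⟨by omega, h2 k rfl⟩, rfl⟩
      · rintro (h | ⟨i, ⟨h1, h2⟩, h3⟩)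
        · omega
        · obtain rfl : i = k := by simpa using h3
          refine ⟨?_, fun j hj => ?_⟩
          · by_contra h
            rw [hp.apply_eq_zero (i := i) (by omega)] at h2
            omega
          · obtain rfl : j = i := by omega
            exact h2
  rw [h1, Finset.card_insert_of_notMem (by simp), Finset.card_map]

open Classical in
/-- The up operator on the Young graph has the dimension function as an eigenvector. -/
lemma sum_ptnDim_addBox {n N : ℕ} {f : ℕ → ℕ} (hf : f ∈ ptns n) (hN : n < N) :
    ∑ k ∈ Finset.range N, ptnDim (addBox k f) = (n + 1) * ptnDim f := by
  induction n generalizing f N with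
  | zero =>
    rw [ptns_zero, Finset.mem_singleton] at hf
    subst hf
    rw [Finset.sum_eq_single_of_mem 0 (by simpa using hN)]
    · rw [ptnDim_eq_sum_removeBox (n := 0) (N := 1)
        (addBox_mem_ptns (by simp [ptns_zero]) isPtnFun_zero.addBox_zero) one_pos]
      rw [Finset.sum_filter, Finset.sum_range_one, if_pos (by simp [addBox_apply]),
        removeBox_addBox, ptnDim_zero]
      simp
    · intro k _ hk
      refine ptnDim_of_not fun h => ?_
      have := (isPtnFun_zero.addBox_iff k).1 h (k - 1) (by omega)
      simp at this
  | succ n ih =>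
    obtain ⟨hp, hs⟩ := mem_ptns.1 hf
    set a : ℕ → ℕ → ℝ := fun k j =>
      if IsPtnFun (addBox k f) ∧ addBox k f (j + 1) < addBox k f j
      then ptnDim (removeBox j (addBox k f)) else 0 with ha
    set b : ℕ → ℕ → ℝ := fun k j =>
      if f (j + 1) < f j then ptnDim (addBox k (removeBox j f)) else 0 with hb
    have hab : ∀ k j, j ≠ k → a k j = b k j := by
      intro k j hjk
      simp only [ha, hb, removeBox_addBox_comm hjk]
      by_cases h : IsPtnFun (addBox k (removeBox j f))
      · simp only [corner_iff_of_isPtnFun_addBox_removeBox hp hjk h]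
      · simp [ptnDim_of_not h]
    have h1 : ∑ k ∈ Finset.range N, ptnDim (addBox k f) =
        ∑ k ∈ Finset.range N, ∑ j ∈ Finset.range N, a k j := by
      refine Finset.sum_congr rfl fun k _ => ?_
      by_cases hk : IsPtnFun (addBox k f)
      · rw [ptnDim_eq_sum_removeBox (addBox_mem_ptns hf hk) hN, Finset.sum_filter]
        exact Finset.sum_congr rfl fun j _ => by simp [ha, hk]
      · simp [ha, hk, ptnDim_of_not hk]
    have h2 : ∑ k ∈ Finset.range N, ∑ j ∈ Finset.range N, b k j = (n + 1) * ptnDim f := by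
      rw [Finset.sum_comm, ptnDim_eq_sum_removeBox hf (by omega : n < N), Finset.mul_sum,
        Finset.sum_filter]
      refine Finset.sum_congr rfl fun j _ => ?_
      by_cases hj : f (j + 1) < f j
      · simp only [hb, hj, if_true]
        exact ih (removeBox_mem_ptns hf hj) (by omega)
      · simp [hb, hj]
    have h3 : ∀ k, ∑ j ∈ Finset.range N, (a k j - b k j) =
        if k ∈ Finset.range N then a k k - b k k else 0 := by
      intro k
      rw [← Finset.sum_ite_eq' (Finset.range N) k fun j => a k j - b k j]
      refine Finset.sum_congr rfl fun j _ => ?_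
      split_ifs with h
      · rfl
      · rw [hab k j h, sub_self]
    have h4 : ∑ k ∈ Finset.range N, ∑ j ∈ Finset.range N, (a k j - b k j) = ptnDim f := by
      have h5 : ∀ k ∈ Finset.range N, ∑ j ∈ Finset.range N, (a k j - b k j) =
          (if IsPtnFun (addBox k f) then ptnDim f else 0) -
            if f (k + 1) < f k then ptnDim f else 0 := by
        intro k hk
        rw [h3, if_pos hk]
        congr 1
        · simp only [ha, removeBox_addBox]
          have : addBox k f (k + 1) < addBox k f k := by
            have := hp.succ_le k
            simp [addBox_apply]; omega
          simp [this]
        · simp only [hb]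
          split_ifs with h
          · rw [addBox_removeBox (by omega)]
          · rfl
      rw [Finset.sum_congr rfl h5, Finset.sum_sub_distrib, ← Finset.sum_filter,
        ← Finset.sum_filter, Finset.sum_const, Finset.sum_const, card_addable hf hN]
      simp only [nsmul_eq_mul]
      push_cast
      ring
    rw [h1]
    simp only [Finset.sum_sub_distrib] at h4
    push_cast
    linarith

open Classical in
/-- Edges of the Young graph, counted from above and from below. -/
lemma sum_removeBox_eq_sum_addBox (n N : ℕ) (G : ℕ → (ℕ → ℕ) → (ℕ → ℕ) → ℝ) :
    ∑ g ∈ ptns (n + 1), ∑ k ∈ Finset.range N with g (k + 1) < g k, G k (removeBox k g) g =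
      ∑ f ∈ ptns n, ∑ k ∈ Finset.range N with IsPtnFun (addBox k f), G k f (addBox k f) := by
  rw [Finset.sum_sigma', Finset.sum_sigma']
  refine Finset.sum_bij' (fun x _ => ⟨removeBox x.2 x.1, x.2⟩) (fun x _ => ⟨addBox x.2 x.1, x.2⟩)
    ?_ ?_ ?_ ?_ ?_
  · rintro ⟨g, k⟩ h
    simp only [Finset.mem_sigma, Finset.mem_filter] at h ⊢
    refine ⟨removeBox_mem_ptns h.1 h.2.2, h.2.1, ?_⟩
    rw [addBox_removeBox (by omega)]
    exact (mem_ptns.1 h.1).1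
  · rintro ⟨f, k⟩ h
    simp only [Finset.mem_sigma, Finset.mem_filter] at h ⊢
    refine ⟨addBox_mem_ptns h.1 h.2.2, h.2.1, ?_⟩
    have := (mem_ptns.1 h.1).1.succ_le k
    simp [addBox_apply]; omega
  · rintro ⟨g, k⟩ h
    simp only [Finset.mem_sigma, Finset.mem_filter] at h
    simp only [addBox_removeBox (show 0 < g k by omega)]
  · rintro ⟨f, k⟩ h
    simp only [removeBox_addBox]
  · rintro ⟨g, k⟩ h
    simp only [Finset.mem_sigma, Finset.mem_filter] at h
    simp only [addBox_removeBox (show 0 < g k by omega)]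

open Classical in
lemma sum_ptnDim_mul (n : ℕ) (h : (ℕ → ℕ) → ℝ) :
    ∑ g ∈ ptns (n + 1), ptnDim g * h g =
      ∑ f ∈ ptns n, ptnDim f *
        ∑ k ∈ Finset.range (n + 1) with IsPtnFun (addBox k f), h (addBox k f) := by
  simp only [Finset.mul_sum]
  rw [← sum_removeBox_eq_sum_addBox n (n + 1) fun _ f g => ptnDim f * h g]
  refine Finset.sum_congr rfl fun g hg => ?_
  rw [ptnDim_eq_sum_removeBox hg (Nat.lt_succ_self n), Finset.sum_mul]

open Classical in
lemma sum_filter_ptnDim_mul (s : Finset ℕ) (f : ℕ → ℕ) (w : ℕ → ℝ) :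
    ∑ k ∈ s with IsPtnFun (addBox k f), ptnDim (addBox k f) * w k =
      ∑ k ∈ s, ptnDim (addBox k f) * w k := by
  rw [Finset.sum_filter]
  refine Finset.sum_congr rfl fun k _ => ?_
  split_ifs with h
  · rfl
  · rw [ptnDim_of_not h, zero_mul]

/-- The Burnside identity `∑ (f^λ)² = n!`. -/
lemma sum_ptnDim_sq (n : ℕ) : ∑ f ∈ ptns n, ptnDim f ^ 2 = n.factorial := by
  classical
  induction n with
  | zero => simp [ptns_zero, ptnDim_zero]
  | succ n ih =>
    simp only [sq] at ih ⊢
    rw [sum_ptnDim_mul, Nat.factorial_succ, Nat.cast_mul, ← ih, Finset.mul_sum]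
    refine Finset.sum_congr rfl fun f hf => ?_
    have := sum_filter_ptnDim_mul (Finset.range (n + 1)) f fun _ => 1
    simp only [mul_one] at this
    rw [this, sum_ptnDim_addBox hf (Nat.lt_succ_self n)]
    push_cast
    ring

lemma sum_mul_comp_le {n : ℕ} {m : ℕ} (φ : (ℕ → ℕ) → ℕ → ℕ)
    (hφ : ∀ f ∈ ptns n, φ f ∈ ptns m) (hinj : Set.InjOn φ (ptns n)) :
    ∑ f ∈ ptns n, ptnDim f * ptnDim (φ f) ≤ √(n.factorial * m.factorial) := by
  classical
  refine (Real.sum_mul_le_sqrt_mul_sqrt _ _ _).trans ?_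
  rw [Real.sqrt_mul (by positivity), sum_ptnDim_sq]
  refine mul_le_mul_of_nonneg_left (Real.sqrt_le_sqrt ?_) (Real.sqrt_nonneg _)
  rw [← sum_ptnDim_sq m, ← Finset.sum_image (s := ptns n) (g := φ) (f := fun f => ptnDim f ^ 2)
    fun x hx y hy h => hinj hx hy h]
  refine Finset.sum_le_sum_of_subset_of_nonneg ?_ fun _ _ _ => sq_nonneg _
  intro g hg
  obtain ⟨f, hf, rfl⟩ := Finset.mem_image.1 hg
  exact hφ f hf

lemma sqrt_factorial_mul_succ (n : ℕ) :
    √(n.factorial * (n + 1).factorial) = (n + 1).factorial / √(n + 1) := by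
  rw [eq_div_iff (by positivity), ← Real.sqrt_mul (by positivity)]
  rw [show ((n.factorial : ℝ) * (n + 1).factorial * (n + 1)) = ((n + 1).factorial : ℝ) ^ 2 by
    rw [Nat.factorial_succ]; push_cast; ring]
  exact Real.sqrt_sq (by positivity)

lemma addBox_zero_mem_ptns {n : ℕ} {f : ℕ → ℕ} (hf : f ∈ ptns n) : addBox 0 f ∈ ptns (n + 1) :=
  addBox_mem_ptns hf (mem_ptns.1 hf).1.addBox_zero

/-- The overlap of `ptnDim` on `ptns n` with its translate by a box in the first row. -/
noncomputable def rowOverlap (n : ℕ) : ℝ := ∑ f ∈ ptns n, ptnDim f * ptnDim (addBox 0 f)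

lemma rowOverlap_le (n : ℕ) : rowOverlap n ≤ (n + 1).factorial / √(n + 1) :=
  (sum_mul_comp_le (addBox 0) (fun _ => addBox_zero_mem_ptns)
    (addBox_injective 0).injOn).trans_eq (sqrt_factorial_mul_succ n)

lemma rowOverlap_succ_le (n : ℕ) : rowOverlap (n + 1) ≤ (n + 2) * rowOverlap n := by
  classical
  rw [rowOverlap, sum_ptnDim_mul n fun g => ptnDim (addBox 0 g), rowOverlap, Finset.mul_sum]
  refine Finset.sum_le_sum fun f hf => ?_
  have h1 := sum_ptnDim_addBox (addBox_zero_mem_ptns hf) (N := n + 2) (by omega)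
  have h2 : ∑ k ∈ Finset.range (n + 1) with IsPtnFun (addBox k f), ptnDim (addBox 0 (addBox k f)) ≤
      ∑ k ∈ Finset.range (n + 2), ptnDim (addBox k (addBox 0 f)) := by
    simp only [addBox_comm 0]
    refine Finset.sum_le_sum_of_subset_of_nonneg ?_ fun _ _ _ => ptnDim_nonneg _
    exact (Finset.filter_subset _ _).trans (Finset.range_mono (by omega))
  push_cast at h1
  calc _ ≤ ptnDim f * _ := mul_le_mul_of_nonneg_left (h2.trans_eq h1) (ptnDim_nonneg f)
    _ = _ := by ring

/-- The commutation relation between the down operator and the translation by a box in the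
first row. -/
lemma rowOverlap_sub (n : ℕ) : rowOverlap (n + 1) - (n + 1) * rowOverlap n =
    ∑ f ∈ ptns (n + 1) with f 0 = f 1, ptnDim f ^ 2 := by
  classical
  have h1 : ((n : ℝ) + 1) * rowOverlap n = ∑ g ∈ ptns (n + 1), ptnDim g *
      ∑ k ∈ Finset.range (n + 2) with g (k + 1) < g k, ptnDim (addBox 0 (removeBox k g)) := by
    simp only [Finset.mul_sum]
    rw [sum_removeBox_eq_sum_addBox n (n + 2) fun _ f g => ptnDim g * ptnDim (addBox 0 f),
      rowOverlap, Finset.mul_sum]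
    refine Finset.sum_congr rfl fun f hf => ?_
    rw [sum_filter_ptnDim_mul, ← Finset.sum_mul, sum_ptnDim_addBox hf (by omega)]
    ring
  rw [h1, rowOverlap, ← Finset.sum_sub_distrib, Finset.sum_filter]
  refine Finset.sum_congr rfl fun g hg => ?_
  have hp := (mem_ptns.1 hg).1
  rw [ptnDim_eq_sum_removeBox (addBox_zero_mem_ptns hg) (N := n + 2) (by omega), ← mul_sub]
  have h2 : ∀ k, 0 < k → (addBox 0 g (k + 1) < addBox 0 g k ↔ g (k + 1) < g k) := fun k hk => by
    simp [addBox_apply, hk.ne']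
  have h3 : g 1 ≤ g 0 := hp.succ_le 0
  rw [Finset.sum_filter, Finset.sum_filter, Finset.sum_range_succ' _ (n + 1),
    Finset.sum_range_succ' _ (n + 1),
    if_pos (by simp [addBox_apply]; omega), removeBox_addBox]
  have h4 : ∀ k ∈ Finset.range (n + 1),
      (if addBox 0 g (k + 1 + 1) < addBox 0 g (k + 1)
        then ptnDim (removeBox (k + 1) (addBox 0 g)) else 0) =
      if g (k + 1 + 1) < g (k + 1) then ptnDim (addBox 0 (removeBox (k + 1) g)) else 0 := by
    intro k _
    rw [removeBox_addBox_comm (by omega)]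
    simp only [h2 (k + 1) (by omega)]
  rw [Finset.sum_congr rfl h4]
  by_cases h5 : g 0 = g 1
  · rw [if_neg (by simp only [zero_add]; omega), if_pos h5]
    ring
  · rw [if_pos (by simp only [zero_add]; omega), if_neg h5, addBox_removeBox (by omega)]
    ring

/-- Under the Plancherel measure on partitions of `n + 1`, the first two rows have equal length
with probability at most `1 / √(n + 1)`. -/
lemma sum_ptnDim_sq_eq_rows_le (n : ℕ) :
    ∑ f ∈ ptns (n + 1) with f 0 = f 1, ptnDim f ^ 2 ≤ (n + 1).factorial / √(n + 1) := by
  rw [← rowOverlap_sub]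
  have := rowOverlap_succ_le n
  have := rowOverlap_le n
  linarith

open Classical in
/-- A statistic which grows by one along an injection, and is constant along all other edges of the
Young graph, has Plancherel mean at most `2 √n`. -/
lemma sum_ptnDim_sq_mul_le (s : (ℕ → ℕ) → ℕ) (r : (ℕ → ℕ) → ℕ) (h0 : s 0 = 0)
    (hs : ∀ f k, IsPtnFun f → IsPtnFun (addBox k f) →
      s (addBox k f) = s f + if k = r f then 1 else 0)
    (hr : ∀ f, IsPtnFun f → IsPtnFun (addBox (r f) f))
    (hinj : Set.InjOn (fun f => addBox (r f) f) {f | IsPtnFun f}) (n : ℕ) :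
    ∑ f ∈ ptns n, ptnDim f ^ 2 * s f ≤ n.factorial * (2 * √n) := by
  induction n with
  | zero => simp [ptns_zero, h0]
  | succ n ih =>
    have h1 : ∀ f ∈ ptns n, ∑ k ∈ Finset.range (n + 1) with IsPtnFun (addBox k f),
        ptnDim (addBox k f) * (s (addBox k f) : ℝ) ≤
        (n + 1) * (ptnDim f * s f) + ptnDim (addBox (r f) f) := by
      intro f hf
      have hp := (mem_ptns.1 hf).1
      calc _ = ∑ k ∈ Finset.range (n + 1) with IsPtnFun (addBox k f),
            ptnDim (addBox k f) * ((s f : ℝ) + if k = r f then 1 else 0) := by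
            refine Finset.sum_congr rfl fun k hk => ?_
            rw [hs f k hp (Finset.mem_filter.1 hk).2]
            push_cast
            rfl
        _ = (∑ k ∈ Finset.range (n + 1), ptnDim (addBox k f)) * s f +
            ∑ k ∈ Finset.range (n + 1), if k = r f then ptnDim (addBox k f) else 0 := by
            rw [sum_filter_ptnDim_mul, Finset.sum_mul, ← Finset.sum_add_distrib]
            refine Finset.sum_congr rfl fun k _ => ?_
            split_ifs <;> ring
        _ ≤ _ := by
            rw [sum_ptnDim_addBox hf (Nat.lt_succ_self n), Finset.sum_ite_eq', mul_assoc]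
            gcongr
            split_ifs
            · exact le_rfl
            · exact ptnDim_nonneg _
    have h2 := (sum_mul_comp_le (n := n) (fun f => addBox (r f) f)
      (fun f hf => addBox_mem_ptns hf (hr f (mem_ptns.1 hf).1))
      (hinj.mono fun f hf => (mem_ptns.1 hf).1)).trans_eq (sqrt_factorial_mul_succ n)
    have h3 : 2 * √(n : ℝ) + 1 / √(n + 1) ≤ 2 * √(n + 1) := by
      have hpos : 0 < √((n : ℝ) + 1) := by positivity
      have h4 := Real.sq_sqrt (show (0 : ℝ) ≤ n + 1 by positivity)
      have h5 := Real.sq_sqrt (show (0 : ℝ) ≤ n by positivity)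
      have h6 : (1 : ℝ) / √(n + 1) * √(n + 1) = 1 := by field_simp
      nlinarith [sq_nonneg (√((n : ℝ) + 1) - √n)]
    simp only [sq, mul_assoc]
    rw [sum_ptnDim_mul n fun g => ptnDim g * s g]
    calc _ ≤ ∑ f ∈ ptns n, ptnDim f * ((n + 1) * (ptnDim f * s f) + ptnDim (addBox (r f) f)) :=
          Finset.sum_le_sum fun f hf => mul_le_mul_of_nonneg_left (h1 f hf) (ptnDim_nonneg f)
      _ = (n + 1) * ∑ f ∈ ptns n, ptnDim f ^ 2 * s f +
          ∑ f ∈ ptns n, ptnDim f * ptnDim (addBox (r f) f) := by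
          rw [Finset.mul_sum, ← Finset.sum_add_distrib]
          exact Finset.sum_congr rfl fun f _ => by ring
      _ ≤ (n + 1) * (n.factorial * (2 * √n)) + (n + 1).factorial / √(n + 1) := by gcongr
      _ = (n + 1).factorial * (2 * √n + 1 / √(n + 1)) := by
          rw [Nat.factorial_succ]; push_cast; ring
      _ ≤ (n + 1).factorial * (2 * √((n + 1 : ℕ) : ℝ)) := by
          push_cast
          gcongr

lemma sum_det_updateRow_mul {N : ℕ} (M : Matrix (Fin N) (Fin N) ℝ) (c : Fin N → ℝ) :
    ∑ i, (M.updateRow i fun j => M i j * c j).det = (∑ j, c j) * M.det := by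
  simp only [Matrix.det_apply', Finset.mul_sum]
  rw [Finset.sum_comm]
  refine Finset.sum_congr rfl fun σ _ => ?_
  have h : ∀ i, (∏ k, (M.updateRow i fun j => M i j * c j) (σ k) k) =
      (∏ k, M (σ k) k) * c (σ.symm i) := by
    intro i
    rw [← Finset.mul_prod_erase _ _ (Finset.mem_univ (σ.symm i)),
      ← Finset.mul_prod_erase _ (fun k => M (σ k) k) (Finset.mem_univ (σ.symm i))]
    have h1 : ∀ k ∈ Finset.univ.erase (σ.symm i),
        (M.updateRow i fun j => M i j * c j) (σ k) k = M (σ k) k := by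
      intro k hk
      rw [Matrix.updateRow_ne]
      rintro rfl
      simp at hk
    rw [Finset.prod_congr rfl h1]
    simp only [Equiv.apply_symm_apply, Matrix.updateRow_self]
    ring
  simp only [h]
  rw [← Finset.mul_sum, ← Finset.mul_sum, Equiv.sum_comp σ.symm c]
  ring

/-- A discrete analogue of the Euler relation for the Vandermonde determinant. -/
lemma sum_mul_det_vandermonde_sub {N : ℕ} (x : Fin N → ℝ) :
    ∑ i, x i * (Matrix.vandermonde (Function.update x i (x i - 1))).det =
      (∑ i, x i - ∑ i : Fin N, (i : ℝ)) * (Matrix.vandermonde x).det := by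
  have hV : ∀ y : Fin N → ℝ, (Matrix.vandermonde y).det =
      (Matrix.of fun i j => (descPochhammer ℝ (j : ℕ)).eval (y i) :
        Matrix (Fin N) (Fin N) ℝ).det := fun y =>
    Matrix.det_eval_matrixOfPolynomials_eq_det_vandermonde y (fun j => descPochhammer ℝ (j : ℕ))
      (fun j => descPochhammer_natDegree ℝ j) fun j => monic_descPochhammer ℝ j
  simp only [hV]
  set M : Matrix (Fin N) (Fin N) ℝ :=
    Matrix.of fun i j => (descPochhammer ℝ (j : ℕ)).eval (x i) with hM
  have h1 : ∀ i, x i * (Matrix.of fun k j => (descPochhammer ℝ (j : ℕ)).eval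
      (Function.update x i (x i - 1) k) : Matrix (Fin N) (Fin N) ℝ).det =
      x i * M.det - (M.updateRow i fun j => M i j * (j : ℝ)).det := by
    intro i
    have h2 : (Matrix.of fun k j => (descPochhammer ℝ (j : ℕ)).eval
        (Function.update x i (x i - 1) k) : Matrix (Fin N) (Fin N) ℝ) =
        M.updateRow i fun j => (descPochhammer ℝ (j : ℕ)).eval (x i - 1) := by
      ext k j
      by_cases hk : k = i
      · subst hk; simp
      · simp [hM, hk]
    have h3 : x i • (fun j : Fin N => (descPochhammer ℝ (j : ℕ)).eval (x i - 1)) =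
        x i • M i - fun j => M i j * (j : ℝ) := by
      ext j
      have h4 := descPochhammer_succ_eval (j : ℕ) (x i)
      rw [descPochhammer_succ_left] at h4
      simp only [Polynomial.eval_mul, Polynomial.eval_X, Polynomial.eval_comp, Polynomial.eval_sub,
        Polynomial.eval_one] at h4
      simp only [Pi.smul_apply, smul_eq_mul, Pi.sub_apply, hM, Matrix.of_apply, h4]
      ring
    rw [h2, ← Matrix.det_updateRow_smul, h3, sub_eq_add_neg, Matrix.det_updateRow_add,
      Matrix.det_updateRow_smul, Matrix.updateRow_eq_self, ← neg_one_smul ℝ fun j => _,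
      Matrix.det_updateRow_smul]
    ring
  rw [Finset.sum_congr rfl fun i _ => h1 i, Finset.sum_sub_distrib, sum_det_updateRow_mul, sub_mul,
    Finset.sum_mul Finset.univ x]

/-- The strictly decreasing sequence `f i + (N - 1 - i)` attached to a partition with at most `N`
parts. -/
def shifted (N : ℕ) (f : ℕ → ℕ) (i : ℕ) : ℕ := f i + (N - 1 - i)

/-- Up to a sign and a factorial, the right hand side of the Frobenius formula for the number of
standard Young tableaux. -/
noncomputable def frobeniusRatio (N : ℕ) (f : ℕ → ℕ) : ℝ :=
  (Matrix.vandermonde fun i : Fin N => (shifted N f i : ℝ)).det /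
    ∏ i : Fin N, ((shifted N f i).factorial : ℝ)

lemma sum_shifted {N : ℕ} {f : ℕ → ℕ} (hN : ∀ i, N ≤ i → f i = 0) :
    ∑ i : Fin N, (shifted N f i : ℝ) - ∑ i : Fin N, (i : ℝ) = psize f := by
  rw [IsPtnFun.psize_eq_sum hN, Fin.sum_univ_eq_sum_range fun i => (shifted N f i : ℝ),
    Fin.sum_univ_eq_sum_range fun i => (i : ℝ), ← Finset.sum_range_reflect (fun i => (i : ℝ)),
    ← Finset.sum_sub_distrib]
  push_cast
  refine Finset.sum_congr rfl fun i _ => ?_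
  simp [shifted]

lemma shifted_removeBox {N k : ℕ} {f : ℕ → ℕ} (hk : 0 < f k) (i : ℕ) :
    shifted N (removeBox k f) i = if i = k then shifted N f i - 1 else shifted N f i := by
  simp only [shifted, removeBox_apply]
  split_ifs with h
  · subst h; omega
  · rfl

lemma frobeniusRatio_removeBox {N : ℕ} {f : ℕ → ℕ} (k : Fin N) (hk : 0 < f k) :
    frobeniusRatio N (removeBox k f) =
      (shifted N f k : ℝ) * (Matrix.vandermonde (Function.update
        (fun i : Fin N => (shifted N f i : ℝ)) k (shifted N f k - 1))).det /
        ∏ i : Fin N, ((shifted N f i).factorial : ℝ) := by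
  have hpos : 0 < shifted N f k := by unfold shifted; omega
  have h1 : (fun i : Fin N => (shifted N (removeBox k f) i : ℝ)) =
      Function.update (fun i : Fin N => (shifted N f i : ℝ)) k (shifted N f k - 1) := by
    ext i
    rw [shifted_removeBox hk]
    by_cases h : i = k
    · subst h
      simp [Nat.cast_sub (show 1 ≤ shifted N f i from hpos)]
    · simp [h, Fin.val_inj]
  have h2 : ∏ i : Fin N, ((shifted N f i).factorial : ℝ) =
      shifted N f k * ∏ i : Fin N, ((shifted N (removeBox k f) i).factorial : ℝ) := by
    rw [← Finset.mul_prod_erase _ _ (Finset.mem_univ k),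
      ← Finset.mul_prod_erase _ (fun i : Fin N => ((shifted N (removeBox k f) i).factorial : ℝ))
        (Finset.mem_univ k), ← mul_assoc]
    congr 1
    · rw [shifted_removeBox hk, if_pos rfl]
      exact_mod_cast (Nat.mul_factorial_pred hpos.ne').symm
    · refine Finset.prod_congr rfl fun i hi => ?_
      rw [shifted_removeBox hk, if_neg]
      simpa [Fin.val_inj] using hi
  rw [frobeniusRatio, h1, h2, mul_div_mul_left _ _ (by exact_mod_cast hpos.ne')]

lemma frobeniusRatio_eq_sum {n N : ℕ} {f : ℕ → ℕ} (hf : f ∈ ptns n) (hN : n ≤ N) :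
    n * frobeniusRatio N f =
      ∑ k ∈ Finset.range N with f (k + 1) < f k, frobeniusRatio N (removeBox k f) := by
  obtain ⟨hp, hs⟩ := mem_ptns.1 hf
  have h0 : ∀ i, N ≤ i → f i = 0 := fun i hi => hp.apply_eq_zero (by omega)
  rw [Finset.sum_filter, ← Fin.sum_univ_eq_sum_range fun k =>
    if f (k + 1) < f k then frobeniusRatio N (removeBox k f) else 0]
  have h1 := sum_mul_det_vandermonde_sub fun i : Fin N => (shifted N f i : ℝ)
  rw [sum_shifted h0, hs] at h1
  rw [frobeniusRatio, ← mul_div_assoc, ← h1, Finset.sum_div]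
  refine Finset.sum_congr rfl fun k _ => ?_
  split_ifs with hk
  · exact (frobeniusRatio_removeBox k (by omega)).symm
  · have hle := hp.succ_le k
    by_cases hkN : (k : ℕ) + 1 < N
    · rw [Matrix.det_vandermonde_eq_zero_iff.2 ⟨k, ⟨k + 1, hkN⟩, ?_, ?_⟩, mul_zero, zero_div]
      · rw [Function.update_self, Function.update_of_ne (by simp [Fin.ext_iff])]
        have : shifted N f k = shifted N f (k + 1) + 1 := by unfold shifted; omega
        simp [this]
      · simp [Fin.ext_iff]
    · have : shifted N f k = 0 := by
        have := h0 (k + 1) (by omega)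
        unfold shifted; omega
      simp [this]

lemma shifted_lt {N : ℕ} {f : ℕ → ℕ} (hf : IsPtnFun f) {i j : ℕ} (hij : i < j) (hj : j < N) :
    shifted N f j < shifted N f i := by
  have := hf.1 hij.le
  unfold shifted; omega

lemma shifted_injective {N : ℕ} {f : ℕ → ℕ} (hf : IsPtnFun f) :
    Function.Injective fun i : Fin N => (shifted N f i : ℝ) := by
  intro i j hij
  have h : shifted N f i = shifted N f j := Nat.cast_injective hij
  rcases lt_trichotomy (i : ℕ) j with h1 | h1 | h1
  · exact absurd h (shifted_lt hf h1 j.2).ne'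
  · exact Fin.ext h1
  · exact absurd h (shifted_lt hf h1 i.2).ne

lemma frobeniusRatio_ne_zero {N : ℕ} {f : ℕ → ℕ} (hf : IsPtnFun f) : frobeniusRatio N f ≠ 0 :=
  div_ne_zero (Matrix.det_vandermonde_ne_zero_iff.2 (shifted_injective hf))
    (Finset.prod_ne_zero_iff.2 fun _ _ => by positivity)

/-- The Frobenius formula, normalised at the empty partition. -/
lemma ptnDim_mul_frobeniusRatio_zero {n N : ℕ} {f : ℕ → ℕ} (hf : f ∈ ptns n) (hN : n ≤ N) :
    ptnDim f * frobeniusRatio N 0 = n.factorial * frobeniusRatio N f := by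
  induction n generalizing f with
  | zero =>
    rw [ptns_zero, Finset.mem_singleton] at hf
    subst hf
    simp [ptnDim_zero]
  | succ n ih =>
    rw [ptnDim_eq_sum_removeBox hf (N := N) (by omega), Nat.factorial_succ, Nat.cast_mul,
      mul_comm ((n + 1 : ℕ) : ℝ), mul_assoc, frobeniusRatio_eq_sum hf hN, Finset.mul_sum,
      Finset.sum_mul]
    refine Finset.sum_congr rfl fun k hk => ?_
    exact ih (removeBox_mem_ptns hf (Finset.mem_filter.1 hk).2) (by omega)

lemma det_vandermonde_add_indicator {N : ℕ} (x : Fin N → ℝ) (hx : Function.Injective x)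
    (S : Finset ℕ) :
    (Matrix.vandermonde fun i : Fin N => x i + if (i : ℕ) ∈ S then 1 else 0).det =
      (Matrix.vandermonde x).det * ∏ i : Fin N, ∏ j : Fin N,
        if (i : ℕ) ∈ S ∧ (j : ℕ) ∉ S then 1 + 1 / (x i - x j) else 1 := by
  have h1 : ∀ i : Fin N, ∏ j : Fin N,
      (if (i : ℕ) ∈ S ∧ (j : ℕ) ∉ S then 1 + 1 / (x i - x j) else 1) =
      ∏ j ∈ {i}ᶜ, if (i : ℕ) ∈ S ∧ (j : ℕ) ∉ S then 1 + 1 / (x i - x j) else 1 := by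
    intro i
    refine (Finset.prod_subset (Finset.subset_univ _) fun j _ hj => if_neg ?_).symm
    obtain rfl : j = i := by simpa using hj
    tauto
  rw [Finset.prod_congr rfl fun i _ => h1 i,
    ← Finset.prod_prod_Ioi_mul_eq_prod_prod_off_diag fun j i : Fin N =>
      if (i : ℕ) ∈ S ∧ (j : ℕ) ∉ S then 1 + 1 / (x i - x j) else 1,
    Matrix.det_vandermonde, Matrix.det_vandermonde, ← Finset.prod_mul_distrib]
  refine Finset.prod_congr rfl fun i _ => ?_
  rw [← Finset.prod_mul_distrib]
  refine Finset.prod_congr rfl fun j hj => ?_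
  have h2 : x j - x i ≠ 0 := sub_ne_zero.2 fun h => (Finset.mem_Ioi.1 hj).ne' (hx h)
  have h3 : x i - x j ≠ 0 := sub_ne_zero.2 fun h => (Finset.mem_Ioi.1 hj).ne (hx h)
  by_cases hi : (i : ℕ) ∈ S <;> by_cases hj' : (j : ℕ) ∈ S <;> simp [hi, hj'] <;> field_simp <;>
    ring

/-- The effect on `frobeniusRatio` of adding a box to every row in `S`. -/
lemma frobeniusRatio_add_indicator {N : ℕ} {f g : ℕ → ℕ} (hf : IsPtnFun f) (S : Finset ℕ)
    (hS : S ⊆ Finset.range N) (hg : ∀ i, g i = f i + if i ∈ S then 1 else 0) :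
    frobeniusRatio N g = frobeniusRatio N f * ∏ a ∈ S,
      ((∏ b ∈ Finset.range N \ S, (1 + 1 / ((shifted N f a : ℝ) - shifted N f b))) /
        (shifted N f a + 1)) := by
  have h1 : ∀ i, (shifted N g i : ℝ) = shifted N f i + if i ∈ S then 1 else 0 := by
    intro i
    simp only [shifted, hg]
    push_cast
    ring
  have hp : ∀ F : ℕ → ℝ, ∏ a ∈ S, F a = ∏ i : Fin N, if (i : ℕ) ∈ S then F i else 1 := by
    intro F
    rw [Fin.prod_univ_eq_prod_range fun i => if i ∈ S then F i else 1, ← Finset.prod_filter,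
      Finset.filter_mem_eq_inter, Finset.inter_eq_right.2 hS]
  have h2 : ∏ i : Fin N, ((shifted N g i).factorial : ℝ) =
      (∏ i : Fin N, ((shifted N f i).factorial : ℝ)) * ∏ a ∈ S, ((shifted N f a : ℝ) + 1) := by
    rw [hp, ← Finset.prod_mul_distrib]
    refine Finset.prod_congr rfl fun i _ => ?_
    have : shifted N g i = shifted N f i + if (i : ℕ) ∈ S then 1 else 0 := by
      simp only [shifted, hg]; ring
    rw [this]
    split_ifs
    · rw [Nat.factorial_succ]; push_cast; ring
    · simp
  have h3 : ∏ i : Fin N, ∏ j : Fin N, (if (i : ℕ) ∈ S ∧ (j : ℕ) ∉ S then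
      1 + 1 / ((shifted N f i : ℝ) - shifted N f j) else 1) =
      ∏ a ∈ S, ∏ b ∈ Finset.range N \ S, (1 + 1 / ((shifted N f a : ℝ) - shifted N f b)) := by
    rw [hp]
    refine Finset.prod_congr rfl fun i _ => ?_
    rw [Fin.prod_univ_eq_prod_range fun j => if (i : ℕ) ∈ S ∧ j ∉ S then
      1 + 1 / ((shifted N f i : ℝ) - shifted N f j) else 1]
    split_ifs with hi
    · simp only [hi, true_and]
      rw [← Finset.prod_filter]
      refine Finset.prod_congr ?_ fun _ _ => rfl
      ext j
      simp only [Finset.mem_filter, Finset.mem_sdiff, Finset.mem_range]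
    · simp [hi]
  rw [frobeniusRatio, frobeniusRatio, h2, Finset.prod_div_distrib, ← h3, div_mul_div_comm,
    ← det_vandermonde_add_indicator _ (shifted_injective hf)]
  simp only [h1]

/-- The effect on the dimension of adding a box to every row in `S`. -/
lemma ptnDim_add_indicator {n m N : ℕ} {f g : ℕ → ℕ} (hf : f ∈ ptns n) (hgm : g ∈ ptns m)
    (hn : n ≤ N) (hm : m ≤ N) (S : Finset ℕ) (hS : S ⊆ Finset.range N)
    (hg : ∀ i, g i = f i + if i ∈ S then 1 else 0) :
    ptnDim g * n.factorial = m.factorial * ptnDim f * ∏ a ∈ S,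
      ((∏ b ∈ Finset.range N \ S, (1 + 1 / ((shifted N f a : ℝ) - shifted N f b))) /
        (shifted N f a + 1)) := by
  have h1 := ptnDim_mul_frobeniusRatio_zero hf hn
  have h2 := ptnDim_mul_frobeniusRatio_zero hgm hm
  rw [frobeniusRatio_add_indicator (mem_ptns.1 hf).1 S hS hg] at h2
  have h3 := frobeniusRatio_ne_zero (N := N) isPtnFun_zero
  generalize (∏ a ∈ S, ((∏ b ∈ Finset.range N \ S, (1 + 1 / ((shifted N f a : ℝ) -
    shifted N f b))) / (shifted N f a + 1))) = P at h2 ⊢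
  apply mul_right_cancel₀ h3
  linear_combination (n.factorial : ℝ) * h2 - m.factorial * P * h1

lemma prod_Ico_one_add_one_div {y : ℝ} {k c : ℕ} (hkc : k ≤ c) (hy : 0 < y + k) :
    ∏ b ∈ Finset.Ico k c, (1 + 1 / (y + b)) = (y + c) / (y + k) := by
  induction c, hkc using Nat.le_induction with
  | base => simp [hy.ne']
  | succ c hc ih =>
    have : (0 : ℝ) < y + c := by
      have : (k : ℝ) ≤ c := by exact_mod_cast hc
      linarith
    rw [Finset.prod_Ico_succ_top hc, ih]
    push_cast
    field_simp
    ring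

/-- A lower bound for the contribution of row `a`, when rows `a` through `c - 1` differ by at
most `h`. -/
lemma le_prod_Ico_div {N : ℕ} {f : ℕ → ℕ} (hf : IsPtnFun f) {a k c : ℕ} (hak : a < k)
    (hkc : k ≤ c) (hcN : c ≤ N) {h : ℝ} (hh : ∀ b, k ≤ b → b < c → (f a : ℝ) - f b ≤ h)
    (hh0 : 0 ≤ h) :
    (h + c - a) / ((h + k - a) * (f a + c - a)) ≤
      (∏ b ∈ Finset.Ico k N, (1 + 1 / ((shifted N f a : ℝ) - shifted N f b))) /
        (shifted N f a + 1) := by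
  have hak' : (a : ℝ) < k := by exact_mod_cast hak
  have hkc' : (k : ℝ) ≤ c := by exact_mod_cast hkc
  have hcN' : (c : ℝ) ≤ N := by exact_mod_cast hcN
  have hfa : (0 : ℝ) ≤ f a := Nat.cast_nonneg _
  have hs : ∀ b, b < N → (shifted N f b : ℝ) = f b + N - 1 - b := by
    intro b hb
    simp only [shifted]
    rw [Nat.cast_add, Nat.sub_sub, Nat.cast_sub (by omega)]
    push_cast; ring
  have hsa := hs a (by omega)
  have hpos : ∀ b ∈ Finset.Ico k N, (0 : ℝ) < shifted N f a - shifted N f b := by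
    intro b hb
    rw [Finset.mem_Ico] at hb
    have := shifted_lt hf (show a < b by omega) hb.2
    exact sub_pos.2 (by exact_mod_cast this)
  have h1 : (h + c - a) / (h + k - a) ≤
      ∏ b ∈ Finset.Ico k c, (1 + 1 / ((shifted N f a : ℝ) - shifted N f b)) := by
    have := prod_Ico_one_add_one_div (y := h - a) hkc (by linarith)
    rw [show h + c - a = h - a + c by ring, show h + k - a = h - a + k by ring, ← this]
    refine Finset.prod_le_prod (fun b hb => ?_) fun b hb => ?_
    · have : (k : ℝ) ≤ b := by exact_mod_cast (Finset.mem_Ico.1 hb).1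
      have : (0 : ℝ) < h - a + b := by linarith
      positivity
    · have hb' := Finset.mem_Ico.1 hb
      have := hpos b (Finset.mem_Ico.2 ⟨hb'.1, by omega⟩)
      have h2 := hh b hb'.1 hb'.2
      gcongr
      rw [hsa, hs b (by omega)]
      linarith
  have h2 : (f a + N - a : ℝ) / (f a + c - a) ≤
      ∏ b ∈ Finset.Ico c N, (1 + 1 / ((shifted N f a : ℝ) - shifted N f b)) := by
    have := prod_Ico_one_add_one_div (y := (f a : ℝ) - a) hcN (by linarith)
    rw [show (f a + N - a : ℝ) = f a - a + N by ring,
      show (f a + c - a : ℝ) = f a - a + c by ring, ← this]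
    refine Finset.prod_le_prod (fun b hb => ?_) fun b hb => ?_
    · have : (c : ℝ) ≤ b := by exact_mod_cast (Finset.mem_Ico.1 hb).1
      have : (0 : ℝ) < f a - a + b := by linarith
      positivity
    · have hb' := Finset.mem_Ico.1 hb
      have := hpos b (Finset.mem_Ico.2 ⟨by omega, hb'.2⟩)
      have : (0 : ℝ) ≤ f b := Nat.cast_nonneg _
      gcongr
      rw [hsa, hs b (by omega)]
      linarith
  rw [← Finset.prod_Ico_consecutive _ hkc hcN, le_div_iff₀ (by positivity)]
  have e1 : (0 : ℝ) < h + k - a := by linarith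
  have e2 : (0 : ℝ) < f a + c - a := by linarith
  have e3 : (0 : ℝ) < h + c - a := by linarith
  have e4 : (0 : ℝ) < f a + N - a := by linarith
  calc _ = (h + c - a) / (h + k - a) * ((f a + N - a) / (f a + c - a)) := by
        rw [hsa]; field_simp; ring
    _ ≤ _ := mul_le_mul h1 h2 (by positivity) ((by positivity : (0 : ℝ) ≤ _).trans h1)

open Classical in
/-- The probability of the event `E` under the Plancherel measure on partitions of `n`. -/
noncomputable def plancherelProb (n : ℕ) (E : (ℕ → ℕ) → Prop) : ℝ :=
  (∑ f ∈ ptns n with E f, ptnDim f ^ 2) / n.factorial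

lemma plancherelProb_mono {n : ℕ} {E E' : (ℕ → ℕ) → Prop} (h : ∀ f ∈ ptns n, E f → E' f) :
    plancherelProb n E ≤ plancherelProb n E' := by
  classical
  refine div_le_div_of_nonneg_right (Finset.sum_le_sum_of_subset_of_nonneg ?_
    fun _ _ _ => sq_nonneg _) (by positivity)
  intro f hf
  rw [Finset.mem_filter] at hf ⊢
  exact ⟨hf.1, h f hf.1 hf.2⟩

lemma plancherelProb_or_le (n : ℕ) (E E' : (ℕ → ℕ) → Prop) :
    plancherelProb n (fun f => E f ∨ E' f) ≤ plancherelProb n E + plancherelProb n E' := by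
  classical
  rw [plancherelProb, plancherelProb, plancherelProb, ← add_div]
  refine div_le_div_of_nonneg_right ?_ (by positivity)
  simp only [Finset.sum_filter]
  rw [← Finset.sum_add_distrib]
  refine Finset.sum_le_sum fun f _ => ?_
  by_cases h : E f <;> by_cases h' : E' f <;> simp [h, h', sq_nonneg]

lemma plancherelProb_exists_le (n : ℕ) (s : Finset ℕ) (E : ℕ → (ℕ → ℕ) → Prop) :
    plancherelProb n (fun f => ∃ k ∈ s, E k f) ≤ ∑ k ∈ s, plancherelProb n (E k) := by
  classical
  induction s using Finset.induction_on with
  | empty => simp [plancherelProb]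
  | insert a s ha ih =>
    rw [Finset.sum_insert ha]
    refine (plancherelProb_mono (E' := fun f => E a f ∨ ∃ k ∈ s, E k f) ?_).trans
      ((plancherelProb_or_le _ _ _).trans (by gcongr))
    intro f _ h
    simpa using h

lemma plancherelProb_true (n : ℕ) : plancherelProb n (fun _ => True) = 1 := by
  simp only [plancherelProb, Finset.filter_true, sum_ptnDim_sq]
  exact div_self (by positivity)

lemma plancherelProb_le_one (n : ℕ) (E : (ℕ → ℕ) → Prop) : plancherelProb n E ≤ 1 :=
  (plancherelProb_mono fun _ _ _ => trivial).trans_eq (plancherelProb_true n)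

lemma plancherelProb_nonneg (n : ℕ) (E : (ℕ → ℕ) → Prop) : 0 ≤ plancherelProb n E :=
  div_nonneg (Finset.sum_nonneg fun _ _ => sq_nonneg _) (by positivity)

lemma plancherelProb_add_not (n : ℕ) (E : (ℕ → ℕ) → Prop) :
    plancherelProb n E + plancherelProb n (fun f => ¬ E f) = 1 := by
  classical
  rw [plancherelProb, plancherelProb, ← add_div, Finset.sum_filter_add_sum_filter_not,
    sum_ptnDim_sq]
  exact div_self (by positivity)

/-- Comparison of the Plancherel measures on two levels through the map adding a box to every row
in `S`. -/
lemma mul_plancherelProb_le {n m N : ℕ} (hn : n ≤ N) (hm : m ≤ N) (S : Finset ℕ)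
    (hS : S ⊆ Finset.range N) {E E' : (ℕ → ℕ) → Prop} {q : ℝ} (hq : 0 ≤ q)
    (hE : ∀ f ∈ ptns n, E f →
      (fun i => f i + if i ∈ S then 1 else 0) ∈ ptns m ∧ E' fun i => f i + if i ∈ S then 1 else 0)
    (hqf : ∀ f ∈ ptns n, E f → q ≤ ∏ a ∈ S,
      ((∏ b ∈ Finset.range N \ S, (1 + 1 / ((shifted N f a : ℝ) - shifted N f b))) /
        (shifted N f a + 1))) :
    (m.factorial / n.factorial : ℝ) * q ^ 2 * plancherelProb n E ≤ plancherelProb m E' := by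
  classical
  set φ : (ℕ → ℕ) → ℕ → ℕ := fun f i => f i + if i ∈ S then 1 else 0 with hφ
  have hinj : Function.Injective φ := fun f g h => funext fun i => by
    have := congrFun h i
    simp only [hφ] at this
    omega
  rw [plancherelProb, plancherelProb, ← mul_div_assoc, Finset.mul_sum]
  have h1 : ∑ f ∈ ptns n with E f, ptnDim (φ f) ^ 2 ≤ ∑ g ∈ ptns m with E' g, ptnDim g ^ 2 := by
    rw [← Finset.sum_image (g := φ) (f := fun g => ptnDim g ^ 2) hinj.injOn]
    refine Finset.sum_le_sum_of_subset_of_nonneg ?_ fun _ _ _ => sq_nonneg _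
    intro g hg
    obtain ⟨f, hf, rfl⟩ := Finset.mem_image.1 hg
    rw [Finset.mem_filter] at hf ⊢
    exact hE f hf.1 hf.2
  rw [div_le_div_iff₀ (by positivity) (by positivity)]
  refine le_trans ?_ (mul_le_mul_of_nonneg_right h1 (by positivity))
  rw [Finset.sum_mul, Finset.sum_mul]
  refine Finset.sum_le_sum fun f hf => ?_
  rw [Finset.mem_filter] at hf
  have h2 := ptnDim_add_indicator hf.1 (hE f hf.1 hf.2).1 hn hm S hS fun i => rfl
  have h3 := hqf f hf.1 hf.2
  generalize (∏ a ∈ S, ((∏ b ∈ Finset.range N \ S, (1 + 1 / ((shifted N f a : ℝ) -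
    shifted N f b))) / (shifted N f a + 1))) = P at h2 h3
  have h4 : ptnDim (φ f) = m.factorial * ptnDim f * P / n.factorial := by
    rw [eq_div_iff (by positivity), ← h2]
  rw [h4]
  have h5 : q ^ 2 ≤ P ^ 2 := by gcongr
  calc _ = (m.factorial : ℝ) ^ 2 / n.factorial * ptnDim f ^ 2 * q ^ 2 := by ring
    _ ≤ (m.factorial : ℝ) ^ 2 / n.factorial * ptnDim f ^ 2 * P ^ 2 := by gcongr
    _ = _ := by field_simp

/-- The Plancherel measure of a small difference between the first two rows, one step. -/
lemma plancherelProb_gap_succ_le {n : ℕ} (j : ℕ) {X : ℝ} (hX : 0 < X) :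
    plancherelProb n (fun f => f 0 = f 1 + (j + 1) ∧ (f 0 : ℝ) ≤ X) ≤
      4 * X ^ 2 / (n + 1) *
        plancherelProb (n + 1) (fun f => f 0 = f 1 + j ∧ (f 0 : ℝ) ≤ X) := by
  have key := mul_plancherelProb_le (n := n) (m := n + 1) (N := n + 2) (by omega) (by omega) {1}
    (by simp) (E := fun f => f 0 = f 1 + (j + 1) ∧ (f 0 : ℝ) ≤ X)
    (E' := fun f => f 0 = f 1 + j ∧ (f 0 : ℝ) ≤ X) (q := 1 / 2 * (1 / X)) (by positivity) ?_ ?_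
  · rw [div_mul_eq_mul_div, le_div_iff₀ (by positivity)]
    have h1 : ((n + 1).factorial / n.factorial : ℝ) = n + 1 := by
      rw [Nat.factorial_succ]; push_cast; field_simp
    rw [h1] at key
    calc _ = 4 * X ^ 2 * (((n : ℝ) + 1) * (1 / 2 * (1 / X)) ^ 2 *
          plancherelProb n (fun f => f 0 = f 1 + (j + 1) ∧ (f 0 : ℝ) ≤ X)) := by
          field_simp
          ring
      _ ≤ _ := mul_le_mul_of_nonneg_left key (by positivity)
  · rintro f hf ⟨h1, h2⟩
    have h3 : (fun i => f i + if i ∈ ({1} : Finset ℕ) then 1 else 0) = addBox 1 f := by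
      ext i
      simp only [addBox_apply, Finset.mem_singleton]
      split_ifs <;> rfl
    rw [h3]
    refine ⟨addBox_mem_ptns hf (((mem_ptns.1 hf).1.addBox_iff 1).2 fun i hi => ?_), ?_, ?_⟩
    · obtain rfl : i = 0 := by omega
      omega
    · simp [addBox_apply]; omega
    · simpa [addBox_apply] using h2
  · rintro f hf ⟨h1, h2⟩
    have hp := (mem_ptns.1 hf).1
    have h3 : Finset.range (n + 2) \ {1} = insert 0 (Finset.Ico 2 (n + 2)) := by
      ext i
      simp only [Finset.mem_sdiff, Finset.mem_range, Finset.mem_singleton, Finset.mem_insert,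
        Finset.mem_Ico]
      omega
    have h4 := le_prod_Ico_div hp (N := n + 2) (show 1 < 2 by omega) le_rfl (by omega) (h := 0)
      (fun b hb hb' => by omega) le_rfl
    rw [Finset.prod_singleton, h3, Finset.prod_insert (by simp), mul_div_assoc]
    have h5 : (f 1 : ℝ) + 1 ≤ X := by
      refine le_trans ?_ h2
      rw [h1]; push_cast
      have : (0 : ℝ) ≤ j := Nat.cast_nonneg _
      linarith
    refine mul_le_mul ?_ (le_trans ?_ h4) (by positivity) ?_
    · have h6 : (shifted (n + 2) f 0 : ℝ) = shifted (n + 2) f 1 + (j + 2) := by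
        have : shifted (n + 2) f 0 = shifted (n + 2) f 1 + (j + 2) := by unfold shifted; omega
        rw [this]; push_cast; ring
      rw [h6, show ((shifted (n + 2) f 1 : ℝ) - (shifted (n + 2) f 1 + (j + 2))) = -(j + 2) by ring,
        div_neg]
      have : (1 : ℝ) / (j + 2) ≤ 1 / 2 := by
        gcongr
        have : (0 : ℝ) ≤ j := Nat.cast_nonneg _
        linarith
      linarith
    · rw [show ((0 : ℝ) + ((2 : ℕ) : ℝ) - ((1 : ℕ) : ℝ)) = 1 by norm_num, one_mul]
      push_cast
      gcongr
      · have : (0 : ℝ) ≤ f 1 := Nat.cast_nonneg _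
        linarith
      · linarith
    · have h6 : (shifted (n + 2) f 0 : ℝ) = shifted (n + 2) f 1 + (j + 2) := by
        have : shifted (n + 2) f 0 = shifted (n + 2) f 1 + (j + 2) := by unfold shifted; omega
        rw [this]; push_cast; ring
      rw [h6, show ((shifted (n + 2) f 1 : ℝ) - (shifted (n + 2) f 1 + (j + 2))) = -(j + 2) by ring,
        div_neg]
      have : (1 : ℝ) / (j + 2) ≤ 1 := by
        rw [div_le_one (by positivity)]
        have : (0 : ℝ) ≤ j := Nat.cast_nonneg _
        linarith
      linarith

/-- The first two rows of a Plancherel random partition are unlikely to be close. -/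
lemma plancherelProb_gap_le {n : ℕ} (hn : 0 < n) (j : ℕ) {X A : ℝ} (hX : 0 < X)
    (hA : 4 * X ^ 2 ≤ A * n) :
    plancherelProb n (fun f => f 0 = f 1 + j ∧ (f 0 : ℝ) ≤ X) ≤ A ^ j / √n := by
  have hA0 : 0 ≤ A := by
    by_contra h
    have : A * n < 0 := mul_neg_of_neg_of_pos (not_le.1 h) (by exact_mod_cast hn)
    nlinarith [sq_nonneg X]
  induction j generalizing n with
  | zero =>
    obtain ⟨m, rfl⟩ : ∃ m, n = m + 1 := ⟨n - 1, by omega⟩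
    rw [pow_zero]
    refine (plancherelProb_mono (E' := fun f => f 0 = f 1) fun f _ h => h.1).trans ?_
    rw [plancherelProb, div_le_iff₀ (by positivity)]
    have := sum_ptnDim_sq_eq_rows_le m
    push_cast
    rw [one_div_mul_eq_div]
    exact le_trans (le_of_eq (by congr)) this
  | succ j ih =>
    refine (plancherelProb_gap_succ_le j hX).trans ?_
    have h1 := ih (n := n + 1) (by omega) (hA.trans (by push_cast; linarith))
    have h2 : 4 * X ^ 2 / (n + 1) ≤ A := by
      rw [div_le_iff₀ (by positivity)]
      linarith
    calc _ ≤ A * (A ^ j / √((n + 1 : ℕ) : ℝ)) :=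
          mul_le_mul h2 h1 (plancherelProb_nonneg _ _) hA0
      _ = A ^ (j + 1) / √((n + 1 : ℕ) : ℝ) := by ring
      _ ≤ _ := by
          gcongr
          omega

namespace IsPtnFun

variable {f : ℕ → ℕ}

lemma lt_conjFun_iff (hf : IsPtnFun f) {i j : ℕ} : i < conjFun f j ↔ j < f i := by
  have hex : ∃ m, f m ≤ j := by
    obtain ⟨M, hM⟩ := hf.2
    exact ⟨M, by rw [hM M le_rfl]; exact Nat.zero_le _⟩
  classical
  have h1 : {i | j + 1 ≤ f i} = Set.Iio (Nat.find hex) := by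
    ext i
    rw [Set.mem_Iio, Nat.lt_find_iff]
    constructor
    · intro hi m hm
      have : f i ≤ f m := hf.1 hm
      have : j + 1 ≤ f i := hi
      omega
    · intro h
      have := h i le_rfl
      show j + 1 ≤ f i
      omega
  have h2 : conjFun f j = Nat.find hex := by
    rw [conjFun, h1, Set.ncard_eq_toFinset_card', Set.toFinset_Iio, Nat.card_Iio]
  have h3 : i ∈ {i | j + 1 ≤ f i} ↔ i ∈ Set.Iio (Nat.find hex) := by rw [h1]
  rw [h2]
  exact h3.symm

lemma conjFun_zero_le_psize (hf : IsPtnFun f) : conjFun f 0 ≤ psize f := by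
  by_contra h
  have := hf.lt_conjFun_iff.1 (not_le.1 h)
  rw [hf.apply_eq_zero le_rfl] at this
  omega

lemma conjFun_addBox_zero (hf : IsPtnFun f) {k : ℕ} (hk : IsPtnFun (addBox k f)) :
    conjFun (addBox k f) 0 = conjFun f 0 + if k = conjFun f 0 then 1 else 0 := by
  refine eq_of_forall_lt_iff fun i => ?_
  rw [hk.lt_conjFun_iff, addBox_apply]
  have h1 := hf.lt_conjFun_iff (i := i) (j := 0)
  have h2 := hf.lt_conjFun_iff (i := k) (j := 0)
  have h3 := (hf.addBox_iff k).1 hk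
  have h4 := hf.lt_conjFun_iff (i := k - 1) (j := 0)
  have h5 : ∀ i, i + 1 = k → k - 1 = i := fun i hi => by omega
  by_cases hk0 : k = 0
  · subst hk0; split_ifs <;> omega
  · have := h3 (k - 1) (by omega)
    split_ifs <;> omega

lemma addBox_conjFun_zero (hf : IsPtnFun f) : IsPtnFun (addBox (conjFun f 0) f) := by
  rw [hf.addBox_iff]
  intro i hi
  have h1 := hf.lt_conjFun_iff (i := i) (j := 0)
  have h2 := hf.lt_conjFun_iff (i := conjFun f 0) (j := 0)
  omega

lemma addBox_conjFun_injOn : Set.InjOn (fun f => addBox (conjFun f 0) f) {f | IsPtnFun f} := by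
  intro f hf g hg h
  have hf' : IsPtnFun f := hf
  have hg' : IsPtnFun g := hg
  have h1 := hf'.conjFun_addBox_zero hf'.addBox_conjFun_zero
  have h2 := hg'.conjFun_addBox_zero hg'.addBox_conjFun_zero
  simp only [if_true] at h h1 h2
  rw [h, h2] at h1
  have h3 : conjFun f 0 = conjFun g 0 := by omega
  rw [h3] at h
  exact addBox_injective _ h

end IsPtnFun

lemma sum_ptnDim_sq_mul_row_le (n : ℕ) :
    ∑ f ∈ ptns n, ptnDim f ^ 2 * (f 0 : ℕ) ≤ n.factorial * (2 * √n) :=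
  sum_ptnDim_sq_mul_le (fun f => f 0) (fun _ => 0) rfl
    (fun f k _ _ => by simp only [addBox_apply]; split_ifs <;> omega)
    (fun f hf => hf.addBox_zero) (addBox_injective 0).injOn n

lemma sum_ptnDim_sq_mul_conjFun_le (n : ℕ) :
    ∑ f ∈ ptns n, ptnDim f ^ 2 * (conjFun f 0 : ℕ) ≤ n.factorial * (2 * √n) :=
  sum_ptnDim_sq_mul_le (fun f => conjFun f 0) (fun f => conjFun f 0) (by simp [conjFun])
    (fun _ _ hf hk => hf.conjFun_addBox_zero hk)
    (fun f hf => hf.addBox_conjFun_zero) IsPtnFun.addBox_conjFun_injOn n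

/-- Markov's inequality. -/
lemma plancherelProb_lt_le {n : ℕ} (s : (ℕ → ℕ) → ℕ) {Y m : ℝ} (hY : 0 < Y)
    (h : ∑ f ∈ ptns n, ptnDim f ^ 2 * s f ≤ n.factorial * m) :
    plancherelProb n (fun f => Y < s f) ≤ m / Y := by
  classical
  rw [plancherelProb, div_le_div_iff₀ (by positivity) hY, Finset.sum_mul, mul_comm m]
  refine le_trans ?_ h
  calc _ ≤ ∑ f ∈ ptns n with Y < s f, ptnDim f ^ 2 * s f :=
        Finset.sum_le_sum fun f hf =>
          mul_le_mul_of_nonneg_left (Finset.mem_filter.1 hf).2.le (sq_nonneg _)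
    _ ≤ _ := Finset.sum_le_sum_of_subset_of_nonneg (Finset.filter_subset _ _)
        fun _ _ _ => by positivity

lemma add_indicator_range_mem_ptns {n : ℕ} {f : ℕ → ℕ} (hf : f ∈ ptns n) (k : ℕ) :
    (fun i => f i + if i ∈ Finset.range k then 1 else 0) ∈ ptns (n + k) := by
  obtain ⟨hp, hs⟩ := mem_ptns.1 hf
  rw [mem_ptns]
  have h1 : ∀ i, n + k ≤ i → (f i + if i ∈ Finset.range k then 1 else 0) = 0 := by
    intro i hi
    rw [hp.apply_eq_zero (by omega), if_neg (by simp; omega)]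
  refine ⟨⟨fun i j hij => ?_, n + k, h1⟩, ?_⟩
  · have := hp.1 hij
    simp only [Finset.mem_range]
    split_ifs <;> omega
  · have h2 := IsPtnFun.psize_eq_sum (f := f) (N := n + k) fun i hi => hp.apply_eq_zero (by omega)
    rw [IsPtnFun.psize_eq_sum h1, Finset.sum_add_distrib, ← h2, hs]
    congr 1
    rw [Finset.sum_ite_mem, Finset.inter_eq_right.2 (Finset.range_mono (by omega))]
    simp

/-- A partition whose first `c` rows are nearly equal in the mean can be enlarged by a box in each
of its first `√c` rows at a gain in dimension. -/
lemma le_prod_Ico_div_of_sum_le {n N : ℕ} {f : ℕ → ℕ} (hf : f ∈ ptns n) (hN : n ≤ N) {c : ℕ}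
    (hc : 2 ≤ Nat.sqrt c) (hcl : c ≤ conjFun f 0) {B X : ℝ} (hB : 0 ≤ B)
    (hsum : ∑ i ∈ Finset.range c, ((f i : ℝ) - f (c - 1)) ≤ B * c)
    (hX : ((f 0 + conjFun f 0 : ℕ) : ℝ) ≤ X) {a : ℕ} (ha : a < Nat.sqrt c) :
    (a + 1) / (2 * (B + 1) * X) ≤
      (∏ b ∈ Finset.Ico (Nat.sqrt c) N, (1 + 1 / ((shifted N f a : ℝ) - shifted N f b))) /
        (shifted N f a + 1) := by
  obtain ⟨hp, hs⟩ := mem_ptns.1 hf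
  set k := Nat.sqrt c with hk
  have hkc : k * k ≤ c := Nat.sqrt_le c
  have hkc' : 2 * k ≤ c := (Nat.mul_le_mul_right k hc).trans hkc
  have hcn : c ≤ n := hs ▸ hcl.trans hp.conjFun_zero_le_psize
  have hanti : ∀ i j, i ≤ j → (f j : ℝ) ≤ f i := fun i j hij => by exact_mod_cast hp.1 hij
  have hh0 : (0 : ℝ) ≤ f a - f (c - 1) := sub_nonneg.2 (hanti _ _ (by omega))
  refine le_trans ?_ (le_prod_Ico_div hp ha (by omega : k ≤ c) (by omega)
    (h := (f a : ℝ) - f (c - 1))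
    (fun b _ hb => sub_le_sub_left (hanti _ _ (by omega)) _) hh0)
  have hmean : (a + 1) * ((f a : ℝ) - f (c - 1)) ≤ B * c := by
    refine le_trans ?_ hsum
    calc _ = ∑ i ∈ Finset.range (a + 1), ((f a : ℝ) - f (c - 1)) := by
          rw [Finset.sum_const, Finset.card_range, nsmul_eq_mul]; push_cast; ring
      _ ≤ ∑ i ∈ Finset.range (a + 1), ((f i : ℝ) - f (c - 1)) :=
          Finset.sum_le_sum fun i hi =>
            sub_le_sub_right (hanti _ _ (by have := Finset.mem_range.1 hi; omega)) _
      _ ≤ _ := Finset.sum_le_sum_of_subset_of_nonneg (Finset.range_mono (by omega))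
          fun i hi _ => sub_nonneg.2 (hanti _ _ (by have := Finset.mem_range.1 hi; omega))
  have hX' : (f a : ℝ) + c - a ≤ X := by
    have h1 := hanti 0 a (Nat.zero_le _)
    have h2 : (c : ℝ) ≤ conjFun f 0 := by exact_mod_cast hcl
    push_cast at hX
    have : (0 : ℝ) ≤ a := Nat.cast_nonneg _
    linarith
  have ha0 : (0 : ℝ) ≤ a := Nat.cast_nonneg _
  have hak : (a : ℝ) + 1 ≤ k := by exact_mod_cast ha
  have hck : 2 * (k : ℝ) ≤ c := by exact_mod_cast hkc'
  have hkk : (k : ℝ) * k ≤ c := by exact_mod_cast hkc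
  have hfa : (0 : ℝ) ≤ f a := Nat.cast_nonneg _
  generalize (f a : ℝ) - f (c - 1) = h at hh0 hmean ⊢
  have e1 : 0 < h + k - a := by linarith
  have e2 : (0 : ℝ) < f a + c - a := by linarith
  have e3 : 0 < X := e2.trans_le hX'
  rw [div_le_div_iff₀ (by positivity) (by positivity)]
  have h1 : (a + 1) * (h + k - a) ≤ (B + 1) * c := by nlinarith
  have h2 : (B + 1) * c ≤ (h + c - a) * (2 * (B + 1)) := by nlinarith
  calc (a + 1) * ((h + k - a) * (f a + c - a)) = (a + 1) * (h + k - a) * (f a + c - a) := by ring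
    _ ≤ (h + c - a) * (2 * (B + 1)) * X := by
        refine mul_le_mul (h1.trans h2) hX' e2.le ?_
        exact mul_nonneg (by linarith) (by linarith)
    _ = _ := by ring

/-- It is unlikely that the first `c` rows are nearly equal in the mean, for some `c` with
`⌊√c⌋ = k`. -/
lemma plancherelProb_flat_le {n k : ℕ} (hn : 0 < n) (hk : 2 ≤ k) {B X A : ℝ} (hB : 0 ≤ B)
    (hX0 : 0 < X) (hA : (2 * (B + 1) * X) ^ 2 ≤ A * n) :
    plancherelProb n (fun f => ∃ c, Nat.sqrt c = k ∧ c ≤ conjFun f 0 ∧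
      ∑ i ∈ Finset.range c, ((f i : ℝ) - f (c - 1)) ≤ B * c ∧
      ((f 0 + conjFun f 0 : ℕ) : ℝ) ≤ X) ≤ A ^ k / k.factorial := by
  have key := mul_plancherelProb_le (n := n) (m := n + k) (N := n + k) (by omega) le_rfl
    (Finset.range k) (Finset.range_mono (by omega))
    (E := fun f => ∃ c, Nat.sqrt c = k ∧ c ≤ conjFun f 0 ∧
      ∑ i ∈ Finset.range c, ((f i : ℝ) - f (c - 1)) ≤ B * c ∧
      ((f 0 + conjFun f 0 : ℕ) : ℝ) ≤ X) (E' := fun _ => True)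
    (q := ∏ a ∈ Finset.range k, ((a : ℝ) + 1) / (2 * (B + 1) * X)) (by positivity)
    (fun f hf _ => ⟨add_indicator_range_mem_ptns hf k, trivial⟩) ?_
  · have h1 := key.trans (plancherelProb_le_one _ _)
    have h0 := plancherelProb_nonneg n (fun f => ∃ c, Nat.sqrt c = k ∧ c ≤ conjFun f 0 ∧
      ∑ i ∈ Finset.range c, ((f i : ℝ) - f (c - 1)) ≤ B * c ∧
      ((f 0 + conjFun f 0 : ℕ) : ℝ) ≤ X)
    generalize plancherelProb n (fun f => ∃ c, Nat.sqrt c = k ∧ c ≤ conjFun f 0 ∧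
      ∑ i ∈ Finset.range c, ((f i : ℝ) - f (c - 1)) ≤ B * c ∧
      ((f 0 + conjFun f 0 : ℕ) : ℝ) ≤ X) = P at h0 h1 ⊢
    have hA0 : 0 ≤ A := by
      by_contra h
      have : A * n < 0 := mul_neg_of_neg_of_pos (not_le.1 h) (by exact_mod_cast hn)
      nlinarith [sq_nonneg (2 * (B + 1) * X)]
    set W := 2 * (B + 1) * X with hW
    have hWpos : 0 < W := by positivity
    have h2 : ∏ a ∈ Finset.range k, ((a : ℝ) + 1) / W = k.factorial / W ^ k := by
      rw [Finset.prod_div_distrib, Finset.prod_const, Finset.card_range,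
        ← Finset.prod_range_add_one_eq_factorial]
      push_cast
      rfl
    have h3 : (n : ℝ) ^ k ≤ (n + k).factorial / n.factorial := by
      rw [le_div_iff₀ (by positivity), mul_comm]
      exact_mod_cast (Nat.mul_le_mul_left _ (Nat.pow_le_pow_left (Nat.le_succ n) k)).trans
        Nat.factorial_mul_pow_le_factorial
    have h4 : (n : ℝ) ^ k * (k.factorial / W ^ k) ^ 2 * P ≤ 1 := by
      rw [h2] at h1
      exact le_trans (by gcongr) h1
    have h5 : (W ^ k) ^ 2 ≤ A ^ k * (n : ℝ) ^ k := by
      rw [← pow_mul, mul_comm k 2, pow_mul, ← mul_pow]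
      gcongr
    have h6 : (1 : ℝ) ≤ k.factorial := by exact_mod_cast Nat.factorial_pos k
    have hnk : (0 : ℝ) < (n : ℝ) ^ k := pow_pos (by exact_mod_cast hn) k
    rw [le_div_iff₀ (by positivity)]
    refine le_of_mul_le_mul_right ?_ hnk
    calc P * k.factorial * (n : ℝ) ^ k ≤ P * (k.factorial * k.factorial) * (n : ℝ) ^ k := by
          gcongr
          exact le_mul_of_one_le_left (by positivity) h6
      _ = (n : ℝ) ^ k * (k.factorial / W ^ k) ^ 2 * P * (W ^ k) ^ 2 := by field_simp
      _ ≤ 1 * (A ^ k * (n : ℝ) ^ k) := by gcongr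
      _ = _ := one_mul _
  · rintro f hf ⟨c, rfl, hcl, hsum, hfX⟩
    refine Finset.prod_le_prod (fun _ _ => by positivity) fun a ha => ?_
    have h3 : Finset.range (n + Nat.sqrt c) \ Finset.range (Nat.sqrt c) =
        Finset.Ico (Nat.sqrt c) (n + Nat.sqrt c) := by
      ext i
      simp only [Finset.mem_sdiff, Finset.mem_range, Finset.mem_Ico]
      omega
    rw [h3]
    exact le_prod_Ico_div_of_sum_le hf (by omega) hk hcl hB hsum hfX (Finset.mem_range.1 ha)

/-- A partition which is not sum-flexible has either nearly equal first two rows, or many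
nearly equal rows. -/
lemma gap_or_flat_of_not_sumFlexible {f : ℕ → ℕ} (hf : IsPtnFun f) {β : ℝ} (hβ : 0 < β) (K : ℕ)
    (h : ¬ SumFlexible β f) :
    f 0 ≤ f 1 + K ∨ ∃ c : ℕ, β * K < c ∧ c ≤ conjFun f 0 ∧
      ∑ i ∈ Finset.range c, ((f i : ℝ) - f (c - 1)) ≤ β⁻¹ * c := by
  by_cases hK : f 0 ≤ f 1 + K
  · exact Or.inl hK
  refine Or.inr ?_
  have h1 : conjFun f (f 0 - 1) = 1 := by
    refine eq_of_forall_lt_iff fun i => ?_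
    rw [hf.lt_conjFun_iff]
    rcases i with - | i
    · omega
    · have : f (i + 1) ≤ f 1 := hf.1 (by omega)
      omega
  unfold SumFlexible at h
  push Not at h
  obtain ⟨k, hk1, hk2, hk⟩ := h (by omega) h1
  set c := conjFun f (f 0 - k) with hc
  set S : ℕ := ∑ j ∈ Finset.Icc 1 k, conjFun f (f 0 - j) with hS
  have hSc : β * S ≤ c - 1 := by
    have h2 := Int.ceil_le.1 (Int.le_sub_one_of_lt hk)
    rw [hS]
    push_cast at h2 ⊢
    exact h2
  have hS1 : 1 ≤ S := by
    rw [← h1]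
    exact Finset.single_le_sum (f := fun j => conjFun f (f 0 - j)) (fun _ _ => Nat.zero_le _)
      (Finset.mem_Icc.2 ⟨le_rfl, hk1⟩)
  have hc2 : 2 ≤ c := by
    have h2 : 0 < β * S := mul_pos hβ (by exact_mod_cast hS1)
    have h3 : (1 : ℝ) < c := by linarith
    exact_mod_cast h3
  have hfc : f 0 - k < f (c - 1) := hf.lt_conjFun_iff.1 (by omega)
  have hanti : ∀ i j, i ≤ j → f j ≤ f i := fun i j hij => hf.1 hij
  have hsum : ∑ i ∈ Finset.range c, (f i - f (c - 1)) ≤ S := by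
    have h2 : ∀ j, ((Finset.range c).filter fun i => f 0 - j < f i).card ≤ conjFun f (f 0 - j) := by
      intro j
      rw [← Finset.card_range (conjFun f (f 0 - j))]
      refine Finset.card_le_card fun i hi => ?_
      rw [Finset.mem_range, hf.lt_conjFun_iff]
      exact (Finset.mem_filter.1 hi).2
    refine le_trans ?_ (Finset.sum_le_sum fun j _ => h2 j)
    simp only [Finset.card_filter]
    rw [Finset.sum_comm]
    refine Finset.sum_le_sum fun i hi => ?_
    rw [← Finset.card_filter]
    have h3 := hanti 0 i (Nat.zero_le i)
    calc f i - f (c - 1) ≤ (Finset.Icc (f 0 - f i + 1) k).card := by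
          rw [Nat.card_Icc]; omega
      _ ≤ _ := by
          refine Finset.card_le_card fun j hj => ?_
          rw [Finset.mem_Icc] at hj
          rw [Finset.mem_filter, Finset.mem_Icc]
          omega
  have hsum' : ∑ i ∈ Finset.range c, ((f i : ℝ) - f (c - 1)) ≤ S := by
    refine le_trans (le_of_eq ?_) (by exact_mod_cast hsum :
      ((∑ i ∈ Finset.range c, (f i - f (c - 1)) : ℕ) : ℝ) ≤ S)
    push_cast
    refine Finset.sum_congr rfl fun i hi => ?_
    have := hanti i (c - 1) (by have := Finset.mem_range.1 hi; omega)
    rw [Nat.cast_sub this]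
  have hKS : K < S := by
    have h2 : f 0 - f (c - 1) ≤ ∑ i ∈ Finset.range c, (f i - f (c - 1)) :=
      Finset.single_le_sum (f := fun i => f i - f (c - 1)) (fun _ _ => Nat.zero_le _)
        (Finset.mem_range.2 (by omega))
    have h3 := hanti 1 (c - 1) (by omega)
    omega
  refine ⟨c, ?_, ?_, hsum'.trans ?_⟩
  · have : (K : ℝ) < S := by exact_mod_cast hKS
    nlinarith
  · have : c - 1 < conjFun f 0 := hf.lt_conjFun_iff.2 (by omega)
    omega
  · rw [inv_mul_eq_div, le_div_iff₀ hβ]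
    linarith

lemma plancherelProb_not_sumFlexible_le {n K K₀ : ℕ} (hn : 0 < n) (hK₀ : 2 ≤ K₀) {β D : ℝ}
    (hβ : 0 < β) (hD : 0 < D) (hK : (K₀ : ℝ) ^ 2 ≤ β * K) :
    plancherelProb n (fun f => ¬ SumFlexible β f) ≤ 4 / D +
      ((∑ j ∈ Finset.range (K + 1), (16 * D ^ 2) ^ j) / √n +
        ∑ k ∈ Finset.Ico K₀ (n + 1), (16 * (β⁻¹ + 1) ^ 2 * D ^ 2) ^ k / k.factorial) := by
  have hsq : (0 : ℝ) < √n := Real.sqrt_pos.2 (by exact_mod_cast hn)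
  have hsq2 : √(n : ℝ) ^ 2 = n := Real.sq_sqrt (Nat.cast_nonneg n)
  set Y : ℝ := D * √n with hY
  have hY0 : 0 < Y := mul_pos hD hsq
  have hYD : 2 * √(n : ℝ) / Y = 2 / D := by rw [hY]; field_simp
  set G : ℕ → (ℕ → ℕ) → Prop := fun j f => f 0 = f 1 + j ∧ (f 0 : ℝ) ≤ 2 * Y with hG
  set H : ℕ → (ℕ → ℕ) → Prop := fun k f => ∃ c, Nat.sqrt c = k ∧ c ≤ conjFun f 0 ∧
      ∑ i ∈ Finset.range c, ((f i : ℝ) - f (c - 1)) ≤ β⁻¹ * c ∧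
      ((f 0 + conjFun f 0 : ℕ) : ℝ) ≤ 2 * Y with hH
  have hG' : ∀ j, plancherelProb n (G j) ≤ (16 * D ^ 2) ^ j / √n := fun j =>
    plancherelProb_gap_le hn j (by positivity) (by rw [hY]; exact le_of_eq (by linear_combination 16 * D ^ 2 * hsq2))
  have hH' : ∀ k ∈ Finset.Ico K₀ (n + 1), plancherelProb n (H k) ≤
      (16 * (β⁻¹ + 1) ^ 2 * D ^ 2) ^ k / k.factorial := fun k hk =>
    plancherelProb_flat_le hn (hK₀.trans (Finset.mem_Ico.1 hk).1) (by positivity) (by positivity)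
      (by
        rw [hY]
        exact le_of_eq (by linear_combination 16 * (β⁻¹ + 1) ^ 2 * D ^ 2 * hsq2))
  have h1 := plancherelProb_lt_le (fun f => f 0) hY0 (sum_ptnDim_sq_mul_row_le n)
  have h2 := plancherelProb_lt_le (fun f => conjFun f 0) hY0 (sum_ptnDim_sq_mul_conjFun_le n)
  rw [hYD] at h1 h2
  calc plancherelProb n (fun f => ¬ SumFlexible β f)
      ≤ plancherelProb n fun f => (Y < f 0 ∨ Y < conjFun f 0) ∨
          ((∃ j ∈ Finset.range (K + 1), G j f) ∨ ∃ k ∈ Finset.Ico K₀ (n + 1), H k f) := by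
        refine plancherelProb_mono fun f hf h => ?_
        obtain ⟨hp, hs⟩ := mem_ptns.1 hf
        by_cases h3 : Y < f 0
        · exact Or.inl (Or.inl h3)
        by_cases h4 : Y < conjFun f 0
        · exact Or.inl (Or.inr h4)
        refine Or.inr ?_
        rcases gap_or_flat_of_not_sumFlexible hp hβ K h with h5 | ⟨c, hc1, hc2, hc3⟩
        · have := hp.succ_le 0
          refine Or.inl ⟨f 0 - f 1, ?_, ?_, ?_⟩
          · rw [Finset.mem_range]; omega
          · simp only [zero_add] at this; omega
          · linarith
        · refine Or.inr ⟨Nat.sqrt c, ?_, c, rfl, hc2, hc3, ?_⟩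
          · rw [Finset.mem_Ico, Nat.le_sqrt']
            constructor
            · have : ((K₀ ^ 2 : ℕ) : ℝ) ≤ c := by push_cast; linarith
              exact_mod_cast this
            · have := Nat.sqrt_le_self c
              have := hp.conjFun_zero_le_psize
              omega
          · push_cast; linarith
    _ ≤ (2 / D + 2 / D) + (∑ j ∈ Finset.range (K + 1), (16 * D ^ 2) ^ j / √n +
          ∑ k ∈ Finset.Ico K₀ (n + 1), (16 * (β⁻¹ + 1) ^ 2 * D ^ 2) ^ k / k.factorial) := by
        refine (plancherelProb_or_le _ _ _).trans (add_le_add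
          ((plancherelProb_or_le _ _ _).trans (add_le_add h1 h2))
          ((plancherelProb_or_le _ _ _).trans (add_le_add
            ((plancherelProb_exists_le _ _ _).trans (Finset.sum_le_sum fun j _ => hG' j))
            ((plancherelProb_exists_le _ _ _).trans (Finset.sum_le_sum hH')))))
    _ = _ := by rw [Finset.sum_div]; ring

lemma sum_Ico_pow_div_factorial_lt (A : ℝ) (hA : 0 ≤ A) {ε : ℝ} (hε : 0 < ε) :
    ∃ K₀, 2 ≤ K₀ ∧ ∀ m, ∑ k ∈ Finset.Ico K₀ m, A ^ k / k.factorial < ε := by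
  have h1 := tendsto_sum_nat_add fun k => A ^ k / (k.factorial : ℝ)
  obtain ⟨K₀, h2, h3⟩ := ((h1.eventually (gt_mem_nhds hε)).and
    (Filter.eventually_ge_atTop 2)).exists
  refine ⟨K₀, h3, fun m => lt_of_le_of_lt ?_ h2⟩
  rw [Finset.sum_Ico_eq_sum_range]
  simp only [add_comm K₀]
  exact ((summable_nat_add_iff K₀).2 (Real.summable_pow_div_factorial A)).sum_le_tsum _
    fun k _ => by positivity

lemma tendsto_plancherelProb_not_sumFlexible {β : ℝ} (hβ : 0 < β) :
    Filter.Tendsto (fun n => plancherelProb n fun f => ¬ SumFlexible β f) Filter.atTop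
      (nhds 0) := by
  refine Metric.tendsto_atTop.2 fun ε hε => ?_
  set D : ℝ := 12 / ε with hD
  have hD0 : 0 < D := by positivity
  obtain ⟨K₀, hK₀, hsum⟩ := sum_Ico_pow_div_factorial_lt (16 * (β⁻¹ + 1) ^ 2 * D ^ 2)
    (by positivity) (show 0 < ε / 3 by positivity)
  obtain ⟨K, hK⟩ := exists_nat_ge ((K₀ : ℝ) ^ 2 / β)
  rw [div_le_iff₀' hβ] at hK
  have h1 : Filter.Tendsto (fun n : ℕ => (∑ j ∈ Finset.range (K + 1), (16 * D ^ 2) ^ j) / √n)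
      Filter.atTop (nhds 0) :=
    (Real.tendsto_sqrt_atTop.comp tendsto_natCast_atTop_atTop).const_div_atTop _
  obtain ⟨n₀, hn₀⟩ := Filter.eventually_atTop.1
    (h1.eventually (gt_mem_nhds (show 0 < ε / 3 by positivity)))
  refine ⟨n₀ + 1, fun n hn => ?_⟩
  rw [Real.dist_0_eq_abs, abs_of_nonneg (plancherelProb_nonneg _ _)]
  have h2 := plancherelProb_not_sumFlexible_le (n := n) (by omega) hK₀ hβ hD0 hK
  have h3 := hn₀ n (by omega)
  have h4 := hsum (n + 1)
  have h5 : 4 / D = ε / 3 := by rw [hD]; field_simp; norm_num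
  linarith

lemma tsum_sytCount_sq_div_factorial (n : ℕ) (E : (ℕ → ℕ) → Prop) :
    (∑' lam : {f : ℕ → ℕ // IsPtnFun f ∧ psize f = n ∧ E f}, (sytCount lam.1 : ℝ) ^ 2) /
      n.factorial = plancherelProb n E := by
  classical
  rw [plancherelProb]
  congr 1
  have h1 : ∀ f, f ∈ (ptns n).filter E ↔ IsPtnFun f ∧ psize f = n ∧ E f := fun f => by
    rw [Finset.mem_filter, mem_ptns, and_assoc]
  rw [← Finset.tsum_subtype, ← (Equiv.subtypeEquivRight h1).tsum_eq]
  refine tsum_congr fun f => ?_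
  rw [ptnDim_of_isPtnFun ((h1 _).1 f.2).1]
  rfl

/-- For every `β > 0`, the probability under the Plancherel measure (which gives
`λ ⊢ n` probability `(f^λ)²/n!`) that a random partition of `n` is
`β`-sum-flexible tends to `1` as `n → ∞`. -/
theorem plancherel_sum_flexible (β : ℝ) (hβ : 0 < β) :
    Filter.Tendsto
      (fun n : ℕ =>
        (∑' lam : {f : ℕ → ℕ // IsPtnFun f ∧ psize f = n ∧ SumFlexible β f},
            ((sytCount lam.1 : ℝ)) ^ 2) / (n.factorial : ℝ))
      Filter.atTop (nhds 1) := by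
  have h := (tendsto_plancherelProb_not_sumFlexible hβ).const_sub 1
  rw [sub_zero] at h
  refine h.congr fun n => ?_
  rw [tsum_sytCount_sq_div_factorial, ← plancherelProb_add_not n (SumFlexible β)]
  ring
end

section
/- Let f ∈ CY and let A be a real number. (1) If A < h(f), then there exists c > 0 such that every g ∈ CY with sup_{x ∈ ℝ} |f(x) − g(x)| < c satisfies h(g) > A. (2) If A < ℓ(f), then there exists c > 0 such that every g ∈ CY with sup_{x ∈ ℝ} |f(x) − g(x)| < c satisfies ℓ(g) > A. (That is, the height h and the length ℓ are lower semicontinuous on CY with respect to the supremum metric.) -/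
open MeasureTheory

/-- Continuous Young diagrams: `f : ℝ → ℝ` with `f(x) ≥ |x|`, `f` 1-Lipschitz,
and `∫ (f(x) - |x|) dx = 2`. -/
def MemCY (f : ℝ → ℝ) : Prop :=
  (∀ x, |x| ≤ f x) ∧ LipschitzWith 1 f ∧ (∫ x : ℝ, (f x - |x|)) = 2

/-- The height `h(f) = inf {x : f x = x} ∈ ℝ ∪ {+∞}` (`+∞` if the set is empty). -/
noncomputable def hgt (f : ℝ → ℝ) : EReal :=
  sInf ((fun x : ℝ => (x : EReal)) '' {x | f x = x})

/-- The length `ℓ(f) = -sup {x : f x = -x} ∈ ℝ ∪ {+∞}` (`+∞` if the set is empty). -/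
noncomputable def len (f : ℝ → ℝ) : EReal :=
  - sSup ((fun x : ℝ => (x : EReal)) '' {x | f x = -x})

namespace MemCY

variable {f g : ℝ → ℝ}

theorem sub_id_antitone (hf : MemCY f) : Antitone fun x => f x - x := by
  intro x y hxy
  have h := hf.2.1.dist_le_mul y x
  rw [Real.dist_eq, Real.dist_eq, NNReal.coe_one, one_mul, abs_of_nonneg (sub_nonneg.2 hxy)] at h
  have := (abs_le.1 h).2
  simp only
  linarith

theorem add_id_monotone (hf : MemCY f) : Monotone fun x => f x + x := by
  intro x y hxy
  have h := hf.2.1.dist_le_mul y x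
  rw [Real.dist_eq, Real.dist_eq, NNReal.coe_one, one_mul, abs_of_nonneg (sub_nonneg.2 hxy)] at h
  have := (abs_le.1 h).1
  simp only
  linarith

theorem le_abs_add (hf : MemCY f) (x : ℝ) : f x ≤ |x| + f 0 := by
  rcases le_total 0 x with hx | hx
  · have h := hf.sub_id_antitone hx
    simp only at h
    rw [abs_of_nonneg hx]
    linarith
  · have h := hf.add_id_monotone hx
    simp only at h
    rw [abs_of_nonpos hx]
    linarith

theorem bddAbove_abs_sub (hf : MemCY f) (hg : MemCY g) :
    BddAbove (Set.range fun x => |f x - g x|) := by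
  refine ⟨f 0 + g 0, ?_⟩
  rintro _ ⟨x, rfl⟩
  have hf0 := hf.1 0
  have hg0 := hg.1 0
  rw [abs_zero] at hf0 hg0
  refine abs_le.2 ⟨?_, ?_⟩ <;>
    linarith [hf.1 x, hg.1 x, hf.le_abs_add x, hg.le_abs_add x]

theorem sub_lt_of_iSup_lt (hf : MemCY f) (hg : MemCY g) {c : ℝ}
    (h : (⨆ x : ℝ, |f x - g x|) < c) (x : ℝ) : f x - g x < c :=
  (le_abs_self _).trans_lt ((le_ciSup (hf.bddAbove_abs_sub hg) x).trans_lt h)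

theorem id_lt_of_lt_hgt (hf : MemCY f) {x : ℝ} (hx : (x : EReal) < hgt f) : x < f x :=
  ((le_abs_self x).trans (hf.1 x)).lt_of_ne fun h =>
    hx.not_ge (sInf_le (Set.mem_image_of_mem _ h.symm))

theorem le_hgt_of_id_lt (hf : MemCY f) {x : ℝ} (hx : x < f x) : (x : EReal) ≤ hgt f := by
  refine le_sInf ?_
  rintro _ ⟨y, hy, rfl⟩
  refine EReal.coe_le_coe_iff.2 (le_of_not_gt fun hyx => ?_)
  have h := hf.sub_id_antitone hyx.le
  simp only [Set.mem_ofPred_eq] at h hy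
  linarith

theorem neg_lt_of_lt_len (hf : MemCY f) {x : ℝ} (hx : (x : EReal) < len f) : x < f (-x) := by
  refine ((le_abs_self x).trans ((abs_neg x).symm.le.trans (hf.1 (-x)))).lt_of_ne fun h => ?_
  have hmem : f (-x) = - -x := by rw [neg_neg, ← h]
  refine hx.not_ge (EReal.neg_le.2 ?_)
  exact le_sSup ⟨-x, hmem, EReal.coe_neg x⟩

theorem le_len_of_neg_lt (hf : MemCY f) {x : ℝ} (hx : x < f (-x)) : (x : EReal) ≤ len f := by
  refine EReal.le_neg_of_le_neg (sSup_le ?_)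
  rintro _ ⟨y, hy, rfl⟩
  rw [← EReal.coe_neg]
  refine EReal.coe_le_coe_iff.2 (le_of_not_gt fun hyx => ?_)
  have h := hf.add_id_monotone hyx.le
  simp only [Set.mem_ofPred_eq] at h hy
  linarith

end MemCY

/-- Lower semicontinuity of height and length on `CY` for the supremum metric:
if `A < h(f)` (resp. `A < ℓ(f)`) then every `g ∈ CY` with `sup |f - g| < c`
satisfies `A < h(g)` (resp. `A < ℓ(g)`), for some `c > 0`. -/
theorem height_length_lowerSemicontinuous (f : ℝ → ℝ) (hf : MemCY f) (A : ℝ) :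
    (((A : EReal) < hgt f) → ∃ c : ℝ, 0 < c ∧ ∀ g : ℝ → ℝ, MemCY g →
      (⨆ x : ℝ, |f x - g x|) < c → (A : EReal) < hgt g) ∧
    (((A : EReal) < len f) → ∃ c : ℝ, 0 < c ∧ ∀ g : ℝ → ℝ, MemCY g →
      (⨆ x : ℝ, |f x - g x|) < c → (A : EReal) < len g) := by
  constructor
  · intro hA
    obtain ⟨B, hAB, hB⟩ := EReal.lt_iff_exists_real_btwn.1 hA
    refine ⟨f B - B, sub_pos.2 (hf.id_lt_of_lt_hgt hB), fun g hg hc => ?_⟩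
    have := hf.sub_lt_of_iSup_lt hg hc B
    exact hAB.trans_le (hg.le_hgt_of_id_lt (by linarith))
  · intro hA
    obtain ⟨B, hAB, hB⟩ := EReal.lt_iff_exists_real_btwn.1 hA
    refine ⟨f (-B) - B, sub_pos.2 (hf.neg_lt_of_lt_len hB), fun g hg hc => ?_⟩
    have := hf.sub_lt_of_iSup_lt hg hc (-B)
    exact hAB.trans_le (hg.le_len_of_neg_lt (by linarith))
end

section
/- Let F : (0, ∞) → [0, ∞) be non-increasing and right-continuous with ∫₀^∞ F(x) dx = 1, and define H_F(t) = ∫₀^t F(x) dx for t ≥ 0. Then for every ε > 0 there exists δ > 0 with the following property: for every non-increasing right-continuous G : (0, ∞) → [0, ∞) with ∫₀^∞ G(x) dx = 1 such that G(x) ≥ F(x + δ) − δ for all x > 0 and G(x) ≤ F(x − δ) + δ for all x > δ, one has sup_{t ≥ 0} |H_F(t) − H_G(t)| ≤ ε. -/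
open MeasureTheory

/-- `H_F(t) = ∫₀^t F(x) dx`. -/
noncomputable def Hfun (F : ℝ → ℝ) (t : ℝ) : ℝ := ∫ x in Set.Ioc 0 t, F x

theorem integral_Ioi_comp_add_right (F : ℝ → ℝ) (δ : ℝ) :
    ∫ x in Set.Ioi 0, F (x + δ) = ∫ x in Set.Ioi δ, F x := by
  have h := (measurePreserving_add_right volume δ).setIntegral_preimage_emb
    (measurableEmbedding_addRight δ) F (Set.Ioi δ)
  simpa using h

theorem integrableOn_Ioi_comp_add_right {F : ℝ → ℝ} {δ : ℝ} (hF : IntegrableOn F (Set.Ioi δ)) :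
    IntegrableOn (fun x => F (x + δ)) (Set.Ioi 0) := by
  have h := (measurePreserving_add_right volume δ).integrableOn_comp_preimage
    (measurableEmbedding_addRight δ) (f := F) (s := Set.Ioi δ)
  simpa [Function.comp_def] using h.2 hF

theorem tendsto_setIntegral_Ioc_nhdsGT_zero {F : ℝ → ℝ} (hF : IntegrableOn F (Set.Ioi 0)) :
    Filter.Tendsto (fun δ => ∫ x in Set.Ioc 0 δ, F x) (nhdsWithin 0 (Set.Ioi 0)) (nhds 0) := by
  have hvol : Filter.Tendsto (volume.restrict (Set.Ioi (0 : ℝ)) ∘ fun δ : ℝ => Set.Ioc 0 δ)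
      (nhdsWithin 0 (Set.Ioi 0)) (nhds 0) := by
    have h : Filter.Tendsto (fun δ : ℝ => ENNReal.ofReal δ) (nhdsWithin 0 (Set.Ioi 0))
        (nhds 0) := by
      simpa using (ENNReal.continuous_ofReal.tendsto (0 : ℝ)).mono_left nhdsWithin_le_nhds
    refine h.congr fun δ => ?_
    simp [Measure.restrict_apply, Set.inter_eq_left.2 Set.Ioc_subset_Ioi_self]
  refine (hF.tendsto_setIntegral_nhds_zero hvol).congr fun δ => ?_
  rw [Measure.restrict_restrict measurableSet_Ioc,
    Set.inter_eq_left.2 Set.Ioc_subset_Ioi_self]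

theorem setIntegral_Ioc_add_setIntegral_Ioi {F : ℝ → ℝ} (hF : IntegrableOn F (Set.Ioi 0))
    {t : ℝ} (ht : 0 ≤ t) :
    (∫ x in Set.Ioc 0 t, F x) + ∫ x in Set.Ioi t, F x = ∫ x in Set.Ioi 0, F x := by
  rw [← Set.Ioc_union_Ioi_eq_Ioi ht, setIntegral_union Set.Ioc_disjoint_Ioi_same
    measurableSet_Ioi (hF.mono_set Set.Ioc_subset_Ioi_self)
    (hF.mono_set (Set.Ioi_subset_Ioi ht))]

theorem exists_setIntegral_Ioi_le {F : ℝ → ℝ} (hF : IntegrableOn F (Set.Ioi 0))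
    {ε : ℝ} (hε : 0 < ε) : ∃ T : ℝ, 0 < T ∧ ∫ x in Set.Ioi T, F x ≤ ε := by
  have h := intervalIntegral_tendsto_integral_Ioi 0 hF Filter.tendsto_id
  obtain ⟨T, hT, hT0⟩ := ((h.eventually (lt_mem_nhds (sub_lt_self _ hε))).and
    (Filter.eventually_gt_atTop 0)).exists
  refine ⟨T, hT0, ?_⟩
  rw [id, intervalIntegral.integral_of_le hT0.le] at hT
  linarith [setIntegral_Ioc_add_setIntegral_Ioi hF hT0.le]

/-- A one-sided Lévy-type bound controls the integral of `F - G` over every measurable set. -/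
theorem setIntegral_sub_le_of_shift_le {F G : ℝ → ℝ} (hF : AntitoneOn F (Set.Ioi 0))
    (hFnn : ∀ x, 0 < x → 0 ≤ F x) (hGnn : ∀ x, 0 < x → 0 ≤ G x)
    (hFi : IntegrableOn F (Set.Ioi 0)) (hGi : IntegrableOn G (Set.Ioi 0))
    {δ T : ℝ} (hδ : 0 < δ) (hT : 0 < T) (hFG : ∀ x, 0 < x → F (x + δ) - δ ≤ G x)
    {A : Set ℝ} (hAm : MeasurableSet A) (hA : A ⊆ Set.Ioi 0) :
    ∫ x in A, (F x - G x) ≤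
      (∫ x in Set.Ioc 0 δ, F x) + δ * T + ∫ x in Set.Ioi T, F x := by
  let φ : ℝ → ℝ := fun x => (F x - F (x + δ)) + (Set.Ioc 0 T).indicator (fun _ => δ) x +
    (Set.Ioi T).indicator F x
  have hshift : IntegrableOn (fun x => F (x + δ)) (Set.Ioi 0) :=
    integrableOn_Ioi_comp_add_right (hFi.mono_set (Set.Ioi_subset_Ioi hδ.le))
  have hconst : IntegrableOn ((Set.Ioc 0 T).indicator fun _ => δ) (Set.Ioi 0) := by
    refine Integrable.integrableOn ((integrable_indicator_iff measurableSet_Ioc).2 ?_)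
    exact integrableOn_const (by simp)
  have htail : IntegrableOn ((Set.Ioi T).indicator F) (Set.Ioi 0) :=
    Integrable.indicator hFi measurableSet_Ioi
  have hdiff : IntegrableOn (fun x => F x - F (x + δ)) (Set.Ioi 0) := hFi.sub hshift
  have hφi : IntegrableOn φ (Set.Ioi 0) := (hdiff.add hconst).add htail
  have hdec : ∀ x, 0 < x → F (x + δ) ≤ F x := fun x hx =>
    hF (Set.mem_Ioi.2 hx) (Set.mem_Ioi.2 (by linarith)) (by linarith)
  have hφnn : ∀ x ∈ Set.Ioi (0 : ℝ), 0 ≤ φ x := by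
    intro x hx
    have h₁ : 0 ≤ (Set.Ioc 0 T).indicator (fun _ => δ) x :=
      Set.indicator_nonneg (fun _ _ => hδ.le) x
    have h₂ : 0 ≤ (Set.Ioi T).indicator F x :=
      Set.indicator_nonneg (fun y hy => hFnn y (hT.trans hy)) x
    linarith [hdec x hx, show φ x = (F x - F (x + δ)) +
      (Set.Ioc 0 T).indicator (fun _ => δ) x + (Set.Ioi T).indicator F x from rfl]
  have hle : ∀ x ∈ A, F x - G x ≤ φ x := by
    intro x hxA
    have hx : 0 < x := hA hxA
    have := hdec x hx
    have := hFG x hx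
    have := hGnn x hx
    by_cases hxT : x ≤ T
    · simp only [φ, Set.indicator, Set.mem_Ioc, Set.mem_Ioi, hx, hxT, hxT.not_gt, and_self,
        if_true, if_false]
      linarith
    · simp only [φ, Set.indicator, Set.mem_Ioc, Set.mem_Ioi, hxT, not_le.1 hxT, and_false,
        if_true, if_false]
      linarith
  calc ∫ x in A, (F x - G x)
      ≤ ∫ x in A, φ x :=
        setIntegral_mono_on ((hFi.mono_set hA).sub (hGi.mono_set hA)) (hφi.mono_set hA) hAm hle
    _ ≤ ∫ x in Set.Ioi 0, φ x :=
        setIntegral_mono_set hφi ((ae_restrict_iff' measurableSet_Ioi).2 (.of_forall hφnn))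
          hA.eventuallyLE
    _ = (∫ x in Set.Ioc 0 δ, F x) + δ * T + ∫ x in Set.Ioi T, F x := by
        have hδT : ∫ x in Set.Ioi 0, (Set.Ioc 0 T).indicator (fun _ => δ) x = δ * T := by
          rw [setIntegral_indicator measurableSet_Ioc,
            Set.inter_eq_right.2 Set.Ioc_subset_Ioi_self]
          simp [hT.le, mul_comm]
        have hFT : ∫ x in Set.Ioi 0, (Set.Ioi T).indicator F x = ∫ x in Set.Ioi T, F x := by
          rw [setIntegral_indicator measurableSet_Ioi,
            Set.inter_eq_right.2 (Set.Ioi_subset_Ioi hT.le)]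
        have hsum : ∫ x in Set.Ioi 0, φ x = ((∫ x in Set.Ioi 0, F x) -
            ∫ x in Set.Ioi 0, F (x + δ)) +
            (∫ x in Set.Ioi 0, (Set.Ioc 0 T).indicator (fun _ => δ) x) +
            ∫ x in Set.Ioi 0, (Set.Ioi T).indicator F x := by
          rw [← integral_sub hFi hshift, ← integral_add hdiff hconst]
          exact integral_add (hdiff.add hconst) htail
        rw [hsum, hδT, hFT, integral_Ioi_comp_add_right]
        linarith [setIntegral_Ioc_add_setIntegral_Ioi hFi hδ.le]

/-- Let `F : (0,∞) → [0,∞)` be non-increasing, right-continuous, with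
`∫₀^∞ F = 1`.  For every `ε > 0` there is `δ > 0` such that every
non-increasing right-continuous `G : (0,∞) → [0,∞)` with `∫₀^∞ G = 1` that is
within `δ` of `F` in the Lévy-type sense (`G(x) ≥ F(x+δ) - δ` for `x > 0` and
`G(x) ≤ F(x-δ) + δ` for `x > δ`) satisfies `sup_{t ≥ 0} |H_F(t) - H_G(t)| ≤ ε`. -/
theorem area_function_uniformly_close (F : ℝ → ℝ)
    (hF : AntitoneOn F (Set.Ioi 0))
    (hFnn : ∀ x, 0 < x → 0 ≤ F x)
    (hFrc : ∀ x, 0 < x → ContinuousWithinAt F (Set.Ici x) x)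
    (hFint : (∫ x in Set.Ioi (0 : ℝ), F x) = 1) :
    ∀ ε : ℝ, 0 < ε → ∃ δ : ℝ, 0 < δ ∧
      ∀ G : ℝ → ℝ, AntitoneOn G (Set.Ioi 0) → (∀ x, 0 < x → 0 ≤ G x) →
        (∀ x, 0 < x → ContinuousWithinAt G (Set.Ici x) x) →
        (∫ x in Set.Ioi (0 : ℝ), G x) = 1 →
        (∀ x, 0 < x → F (x + δ) - δ ≤ G x) →
        (∀ x, δ < x → G x ≤ F (x - δ) + δ) →
        ∀ t, 0 ≤ t → |Hfun F t - Hfun G t| ≤ ε := by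
  intro ε hε
  have hFi : IntegrableOn F (Set.Ioi 0) := .of_integral_ne_zero (by simp [hFint])
  obtain ⟨T, hT, hFT⟩ := exists_setIntegral_Ioi_le hFi (ε := ε / 3) (by positivity)
  have hsmall : ∀ᶠ δ in nhdsWithin (0 : ℝ) (Set.Ioi 0), δ < ε / 3 / T :=
    nhdsWithin_le_nhds (gt_mem_nhds (by positivity))
  obtain ⟨δ, ⟨hFδ, hδT⟩, hδ⟩ := (((tendsto_setIntegral_Ioc_nhdsGT_zero hFi).eventually
    (gt_mem_nhds (show (0 : ℝ) < ε / 3 by positivity))).and hsmall).and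
      self_mem_nhdsWithin |>.exists
  rw [lt_div_iff₀ hT] at hδT
  refine ⟨δ, hδ, fun G _ hGnn _ hGint hFG _ t ht => ?_⟩
  have hGi : IntegrableOn G (Set.Ioi 0) := .of_integral_ne_zero (by simp [hGint])
  have hIoc : Set.Ioc 0 t ⊆ Set.Ioi 0 := Set.Ioc_subset_Ioi_self
  have hIoi : Set.Ioi t ⊆ Set.Ioi 0 := Set.Ioi_subset_Ioi ht
  have hhead := setIntegral_sub_le_of_shift_le hF hFnn hGnn hFi hGi hδ hT hFG
    measurableSet_Ioc hIoc
  have htail := setIntegral_sub_le_of_shift_le hF hFnn hGnn hFi hGi hδ hT hFG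
    measurableSet_Ioi hIoi
  rw [integral_sub (hFi.mono_set hIoc) (hGi.mono_set hIoc)] at hhead
  rw [integral_sub (hFi.mono_set hIoi) (hGi.mono_set hIoi)] at htail
  have hFsplit := setIntegral_Ioc_add_setIntegral_Ioi hFi ht
  have hGsplit := setIntegral_Ioc_add_setIntegral_Ioi hGi ht
  unfold Hfun
  rw [abs_le]
  constructor <;> linarith
end

section
/- Let μ be a partition with distinct parts μ_1 > μ_2 > … > μ_r > 0, and let its cells be the pairs (i, j) with 1 ≤ i ≤ r and 1 ≤ j ≤ μ_i. Suppose L is a labelling of the cells by positive integers such that: (a) for every column index j (1 ≤ j ≤ μ_1), the labels L(i, j), taken over all rows i with μ_i ≥ j, form a permutation of {1, 2, …, c_j}, where c_j = #{i : μ_i ≥ j}; and (b) for every t with 1 ≤ t ≤ μ_1, the labels L(i, μ_i − t + 1), taken over all rows i with μ_i ≥ t, form a permutation of {1, 2, …, c_t}. Then L(i, j) = i for every cell (i, j). -/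
open Finset

/-- A finite set of positive integers closed under passing to smaller positive integers is
an initial interval. -/
theorem Finset.eq_Icc_one_card_of_lower (s : Finset ℕ) (hs : ∀ i ∈ s, 1 ≤ i)
    (hlow : ∀ i ∈ s, ∀ k, 1 ≤ k → k ≤ i → k ∈ s) : s = Icc 1 s.card := by
  obtain ⟨m, hm⟩ : ∃ m, s = Icc 1 m := by
    rcases s.eq_empty_or_nonempty with rfl | hne
    · exact ⟨0, by simp⟩
    · refine ⟨s.max' hne, ?_⟩
      ext k
      rw [mem_Icc]
      exact ⟨fun hk => ⟨hs k hk, s.le_max' k hk⟩,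
        fun hk => hlow _ (s.max'_mem hne) k hk.1 hk.2⟩
  have hcard : s.card = m := by simp [hm]
  rw [hcard, hm]

theorem Finset.sum_Icc_one_reflect (n : ℕ) (h : ℕ → ℤ) :
    ∑ j ∈ Icc 1 n, h (n - j + 1) = ∑ j ∈ Icc 1 n, h j := by
  refine sum_nbij' (fun j => n - j + 1) (fun j => n - j + 1) ?_ ?_ ?_ ?_ ?_ <;>
    intro j hj <;> simp only [mem_Icc] at * <;> omega

theorem strictAntiOn_Icc_one (r : ℕ) (μ : ℕ → ℕ)
    (hdec : ∀ i, 1 ≤ i → i < r → μ (i + 1) < μ i) : StrictAntiOn μ (Set.Icc 1 r) := by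
  intro a ha b hb hab
  obtain ⟨hb₁, hb₂⟩ := hb
  clear hb₁
  induction b, hab using Nat.le_induction with
  | base => exact hdec a ha.1 hb₂
  | succ b hab ih =>
    have hab' : a < b := hab
    exact (hdec b (ha.1.trans hab'.le) hb₂).trans (ih (by omega))

/-- If every column of a labelling `M` is a permutation of an initial interval, then sums over
the cells of functions of the label and the column do not see the labelling. -/
theorem sum_cells_eq_of_column_perm (r : ℕ) (μ : ℕ → ℕ) (M : ℕ → ℕ → ℕ)
    (hμ : StrictAntiOn μ (Set.Icc 1 r))
    (hM : ∀ j, 1 ≤ j → j ≤ μ 1 →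
      ((Icc 1 r).filter (fun i => j ≤ μ i)).image (fun i => M i j) =
        Icc 1 (((Icc 1 r).filter (fun i => j ≤ μ i)).card))
    (f : ℕ → ℕ → ℤ) :
    ∑ i ∈ Icc 1 r, ∑ j ∈ Icc 1 (μ i), f (M i j) j =
      ∑ i ∈ Icc 1 r, ∑ j ∈ Icc 1 (μ i), f i j := by
  have hanti {a b : ℕ} (h1 : 1 ≤ a) (hab : a ≤ b) (hb : b ≤ r) : μ b ≤ μ a :=
    hμ.antitoneOn ⟨h1, hab.trans hb⟩ ⟨h1.trans hab, hb⟩ hab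
  have swap (F : ℕ → ℕ → ℤ) : ∑ i ∈ Icc 1 r, ∑ j ∈ Icc 1 (μ i), F i j =
      ∑ j ∈ Icc 1 (μ 1), ∑ i ∈ (Icc 1 r).filter (fun i => j ≤ μ i), F i j := by
    refine sum_comm' fun i j => ?_
    simp only [mem_Icc, mem_filter]
    constructor
    · rintro ⟨⟨h1, h2⟩, h3, h4⟩
      exact ⟨⟨⟨h1, h2⟩, h4⟩, h3, h4.trans (hanti le_rfl h1 h2)⟩
    · rintro ⟨⟨h1, h4⟩, h3, -⟩
      exact ⟨h1, h3, h4⟩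
  rw [swap, swap]
  refine sum_congr rfl fun j hj => ?_
  rw [mem_Icc] at hj
  have himg := hM j hj.1 hj.2
  have hcol := eq_Icc_one_card_of_lower ((Icc 1 r).filter (fun i => j ≤ μ i))
    (fun i hi => (mem_Icc.1 (mem_filter.1 hi).1).1) (fun i hi k hk hki => by
      simp only [mem_filter, mem_Icc] at hi ⊢
      exact ⟨⟨hk, hki.trans hi.1.2⟩, hi.2.trans (hanti hk hki hi.1.2)⟩)
  have hinj : Set.InjOn (fun i => M i j) ((Icc 1 r).filter (fun i => j ≤ μ i)) := by
    rw [← card_image_iff, himg, Nat.card_Icc, Nat.add_sub_cancel]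
  rw [← hcol] at himg
  rw [← sum_image (f := fun k => f k j) hinj, himg]


/-- Let `μ` be a partition with distinct parts `μ 1 > μ 2 > … > μ r > 0` (rows
indexed `1, …, r`), with cells `(i, j)` for `1 ≤ i ≤ r`, `1 ≤ j ≤ μ i`, and let
`c j = #{i : μ i ≥ j}` be the column lengths.  If a labelling `L` of the cells by
positive integers is such that (a) the labels in each column `j` form a
permutation of `{1, …, c j}`, and (b) for each `1 ≤ t ≤ μ 1` the labels
`L i (μ i - t + 1)`, over the rows `i` with `μ i ≥ t`, form a permutation of
`{1, …, c t}`, then `L (i, j) = i` for every cell. -/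
theorem unique_labelling_of_distinct_rows (r : ℕ) (μ : ℕ → ℕ) (L : ℕ → ℕ → ℕ)
    (hpos : ∀ i, 1 ≤ i → i ≤ r → 0 < μ i)
    (hdec : ∀ i, 1 ≤ i → i < r → μ (i + 1) < μ i)
    (ha : ∀ j, 1 ≤ j → j ≤ μ 1 →
      ((Finset.Icc 1 r).filter (fun i => j ≤ μ i)).image (fun i => L i j) =
        Finset.Icc 1 (((Finset.Icc 1 r).filter (fun i => j ≤ μ i)).card))
    (hb : ∀ t, 1 ≤ t → t ≤ μ 1 →
      ((Finset.Icc 1 r).filter (fun i => t ≤ μ i)).image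
          (fun i => L i (μ i - t + 1)) =
        Finset.Icc 1 (((Finset.Icc 1 r).filter (fun i => t ≤ μ i)).card)) :
    ∀ i j, 1 ≤ i → i ≤ r → 1 ≤ j → j ≤ μ i → L i j = i := by
  have hμ := strictAntiOn_Icc_one r μ hdec
  have hcol := sum_cells_eq_of_column_perm r μ L hμ ha
  have hdiag := sum_cells_eq_of_column_perm r μ (fun i t => L i (μ i - t + 1)) hμ hb
    (fun k t => (μ k : ℤ) * t)
  have hreflect (K : ℕ → ℕ → ℕ) :
      ∑ i ∈ Icc 1 r, ∑ j ∈ Icc 1 (μ i), (μ (K i j) : ℤ) * (μ i - j + 1) =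
        ∑ i ∈ Icc 1 r, ∑ j ∈ Icc 1 (μ i), (μ (K i (μ i - j + 1)) : ℤ) * j := by
    refine sum_congr rfl fun i _ => ?_
    rw [← sum_Icc_one_reflect]
    refine sum_congr rfl fun j hj => ?_
    rw [mem_Icc] at hj
    push_cast [Nat.cast_sub hj.2]
    ring
  have hcross : ∑ i ∈ Icc 1 r, ∑ j ∈ Icc 1 (μ i), (μ (L i j) : ℤ) * μ i =
      ∑ i ∈ Icc 1 r, ∑ j ∈ Icc 1 (μ i), (μ i : ℤ) * μ i := by
    have split (K : ℕ → ℕ → ℕ) :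
        ∑ i ∈ Icc 1 r, ∑ j ∈ Icc 1 (μ i), (μ (K i j) : ℤ) * μ i =
          ∑ i ∈ Icc 1 r, ∑ j ∈ Icc 1 (μ i), (μ (K i j) : ℤ) * (μ i - j + 1) +
            ∑ i ∈ Icc 1 r, ∑ j ∈ Icc 1 (μ i), (μ (K i j) : ℤ) * (j - 1) := by
      simp only [← sum_add_distrib]
      exact sum_congr rfl fun i _ => sum_congr rfl fun j _ => by ring
    rw [split L, split fun i _ => i, hreflect L, hreflect fun i _ => i, hdiag,
      hcol fun k t => (μ k : ℤ) * (t - 1)]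
  have hzero : ∑ i ∈ Icc 1 r, ∑ j ∈ Icc 1 (μ i), ((μ (L i j) : ℤ) - μ i) ^ 2 = 0 := by
    have hsq := hcol fun k _ => (μ k : ℤ) * μ k
    have expand : ∑ i ∈ Icc 1 r, ∑ j ∈ Icc 1 (μ i), ((μ (L i j) : ℤ) - μ i) ^ 2 =
        ∑ i ∈ Icc 1 r, ∑ j ∈ Icc 1 (μ i), (μ (L i j) : ℤ) * μ (L i j) -
          2 * ∑ i ∈ Icc 1 r, ∑ j ∈ Icc 1 (μ i), (μ (L i j) : ℤ) * μ i +
            ∑ i ∈ Icc 1 r, ∑ j ∈ Icc 1 (μ i), (μ i : ℤ) * μ i := by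
      simp only [mul_sum, ← sum_add_distrib, ← sum_sub_distrib]
      exact sum_congr rfl fun i _ => sum_congr rfl fun j _ => by ring
    rw [expand, hsq, hcross]
    ring
  intro i j hi hir hj hji
  have hrow := (sum_eq_zero_iff_of_nonneg fun i _ => sum_nonneg fun j _ => sq_nonneg _).1
    hzero i (mem_Icc.2 ⟨hi, hir⟩)
  have hcell := (sum_eq_zero_iff_of_nonneg fun j _ => sq_nonneg _).1
    hrow j (mem_Icc.2 ⟨hj, hji⟩)
  have heq : μ (L i j) = μ i := by
    exact_mod_cast sub_eq_zero.1 (pow_eq_zero_iff two_ne_zero |>.1 hcell)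
  have hj1 : j ≤ μ 1 := hji.trans (hμ.antitoneOn ⟨le_rfl, hi.trans hir⟩ ⟨hi, hir⟩ hi)
  have hmem : L i j ∈ Icc 1 ((Icc 1 r).filter (fun i => j ≤ μ i)).card := by
    rw [← ha j hj hj1]
    exact mem_image_of_mem (fun i => L i j) (mem_filter.2 ⟨mem_Icc.2 ⟨hi, hir⟩, hji⟩)
  have hcard : ((Icc 1 r).filter (fun i => j ≤ μ i)).card ≤ r := by
    simpa using card_filter_le (Icc 1 r) (fun i => j ≤ μ i)
  rw [mem_Icc] at hmem
  exact hμ.injOn ⟨hmem.1, hmem.2.trans hcard⟩ ⟨hi, hir⟩ heq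
end
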